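/- If φ is a positive kinematic expansive continuous flow on a compact surface, then φ has no singular points. -/

import Mathlib

open Metric Set Filter Topology

/-- A continuous flow on a metric space. -/
def IsFlow {X : Type*} [MetricSpace X] (φ : ℝ → X → X) : Prop :=
  Continuous (fun p : ℝ × X => φ p.1 p.2) ∧ (∀ x, φ 0 x = x) ∧
    ∀ s t x, φ s (φ t x) = φ (s + t) x

/-- Positive kinematic expansiveness. -/
def PosKinematicExpansive {X : Type*} [MetricSpace X] (φ : ℝ → X → X) : Prop :=
  ∀ ε > (0 : ℝ), ∃ δ > (0 : ℝ), ∀ x y : X,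
    (∀ t : ℝ, 0 ≤ t → dist (φ t x) (φ t y) < δ) → ∃ s : ℝ, |s| < ε ∧ y = φ s x

theorem exists_int_abs_sub_lt_of_cos_pos {θ : ℝ → ℝ} {a b c : ℝ} (hab : a ≤ b)
    (hθ : ContinuousOn θ (Icc a b)) (hpos : ∀ t ∈ Icc a b, 0 < Real.cos (θ t - c)) :
    ∃ k : ℤ, ∀ t ∈ Icc a b, |θ t - c - 2 * Real.pi * k| < Real.pi / 2 := by
  have hpi := Real.pi_pos
  have hcos : ∀ (k : ℤ) (t : ℝ), Real.cos (θ t - c - 2 * Real.pi * k) = Real.cos (θ t - c) := by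
    intro k t
    rw [mul_comm]
    exact Real.cos_sub_int_mul_two_pi _ _
  have hne : ∀ (k : ℤ), ∀ t ∈ Icc a b, |θ t - c - 2 * Real.pi * k| ≠ Real.pi / 2 := by
    intro k t ht h
    have h1 := hpos t ht
    rw [← hcos k, ← Real.cos_abs, h, Real.cos_pi_div_two] at h1
    exact lt_irrefl _ h1
  obtain ⟨k, hk⟩ : ∃ k : ℤ, |θ a - c - 2 * Real.pi * k| < Real.pi / 2 := by
    refine ⟨round ((θ a - c) / (2 * Real.pi)), ?_⟩
    set k := round ((θ a - c) / (2 * Real.pi)) with hkdef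
    have hr := abs_sub_round ((θ a - c) / (2 * Real.pi))
    rw [← hkdef] at hr
    have he : θ a - c - 2 * Real.pi * k = ((θ a - c) / (2 * Real.pi) - k) * (2 * Real.pi) := by
      field_simp
    have hle : |θ a - c - 2 * Real.pi * k| ≤ Real.pi := by
      rw [he, abs_mul, abs_of_pos (by positivity : 0 < 2 * Real.pi)]
      nlinarith
    by_contra! hge
    have h1 := hpos a (left_mem_Icc.2 hab)
    rw [← hcos k, ← Real.cos_abs] at h1
    exact absurd h1 (not_lt.2 (Real.cos_nonpos_of_pi_div_two_le_of_le hge (by linarith)))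
  refine ⟨k, fun t ht => ?_⟩
  by_contra! hge
  have hsub : Icc a t ⊆ Icc a b := Icc_subset_Icc_right ht.2
  have hcont : ContinuousOn (fun t => |θ t - c - 2 * Real.pi * k|) (Icc a t) :=
    (((hθ.mono hsub).sub continuousOn_const).sub continuousOn_const).abs
  obtain ⟨s, hs, hs'⟩ := intermediate_value_Icc ht.1 hcont ⟨hk.le, hge⟩
  exact hne k s (hsub hs) hs'

theorem int_eq_of_abs_sub_lt {θ c : ℝ} {k l : ℤ}
    (hk : |θ - c - 2 * Real.pi * k| < Real.pi / 2)
    (hl : |θ - (c + Real.pi / 2) - 2 * Real.pi * l| < Real.pi / 2) : k = l := by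
  have hpi := Real.pi_pos
  rw [abs_lt] at hk hl
  have h1 : (k : ℝ) - l < 1 := by nlinarith
  have h2 : (-1 : ℝ) < k - l := by nlinarith
  have h3 : k - l < 1 := by exact_mod_cast h1
  have h4 : -1 < k - l := by exact_mod_cast h2
  omega

/-- A continuous map on the unit square at distance less than `1` from the inclusion has a zero. -/
theorem exists_eq_zero_of_near_inclusion {F : ℝ × ℝ → ℂ}
    (hF : ContinuousOn F (Icc (-1) 1 ×ˢ Icc (-1) 1))
    (hnear : ∀ q ∈ Icc (-1 : ℝ) 1 ×ˢ Icc (-1 : ℝ) 1,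
      ‖F q - ((q.1 : ℂ) + q.2 * Complex.I)‖ < 1) :
    ∃ q ∈ Icc (-1 : ℝ) 1 ×ˢ Icc (-1 : ℝ) 1, F q = 0 := by
  by_contra! hne
  have h11 : (-1 : ℝ) ≤ 1 := by norm_num
  set P : ℝ × ℝ → ℝ × ℝ := fun q => (projIcc (-1 : ℝ) 1 h11 q.1, projIcc (-1 : ℝ) 1 h11 q.2)
    with hP
  have hPc : Continuous P := by
    refine Continuous.prodMk ?_ ?_
    · exact continuous_subtype_val.comp (continuous_projIcc.comp continuous_fst)
    · exact continuous_subtype_val.comp (continuous_projIcc.comp continuous_snd)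
  have hPm : ∀ q, P q ∈ Icc (-1 : ℝ) 1 ×ˢ Icc (-1 : ℝ) 1 := fun q =>
    ⟨(projIcc (-1 : ℝ) 1 h11 q.1).2, (projIcc (-1 : ℝ) 1 h11 q.2).2⟩
  have hPid : ∀ q ∈ Icc (-1 : ℝ) 1 ×ˢ Icc (-1 : ℝ) 1, P q = q := by
    rintro ⟨x, y⟩ ⟨hx, hy⟩
    simp only [hP, projIcc_of_mem h11 hx, projIcc_of_mem h11 hy]
  have hgc : Continuous (F ∘ P) := hF.comp_continuous hPc hPm
  have hU : IsSimplyConnected (univ : Set (ℝ × ℝ)) := by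
    have : ContractibleSpace (univ : Set (ℝ × ℝ)) :=
      (Homeomorph.Set.univ (ℝ × ℝ)).contractibleSpace
    exact SimplyConnectedSpace.ofContractible _
  obtain ⟨f, hfc, hf⟩ := Complex.exists_continuousOn_eqOn_exp_comp hU isOpen_univ
    hgc.continuousOn (by rintro ⟨q, -, hq⟩; exact hne _ (hPm q) hq)
  have hfc' : Continuous f := continuousOn_univ.1 hfc
  have hval : ∀ q ∈ Icc (-1 : ℝ) 1 ×ˢ Icc (-1 : ℝ) 1, F q = Complex.exp (f q) := by
    intro q hq
    have := hf (mem_univ q)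
    simp only [Function.comp_apply, hPid q hq] at this
    exact this.symm
  set θ : ℝ → ℝ → ℝ := fun x y => (f (x, y)).im with hθ
  have hθx : ∀ x, Continuous fun y => θ x y := fun x =>
    Complex.continuous_im.comp (hfc'.comp (by fun_prop))
  have hθy : ∀ y, Continuous fun x => θ x y := fun y =>
    Complex.continuous_im.comp (hfc'.comp (by fun_prop))
  have hre : ∀ x ∈ Icc (-1 : ℝ) 1, ∀ y ∈ Icc (-1 : ℝ) 1,
      |Real.exp (f (x, y)).re * Real.cos (θ x y) - x| < 1 := by
    intro x hx y hy
    have h1 := (Complex.abs_re_le_norm _).trans_lt (hnear (x, y) ⟨hx, hy⟩)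
    rw [hval _ ⟨hx, hy⟩] at h1
    simpa [Complex.exp_re] using h1
  have him : ∀ x ∈ Icc (-1 : ℝ) 1, ∀ y ∈ Icc (-1 : ℝ) 1,
      |Real.exp (f (x, y)).re * Real.sin (θ x y) - y| < 1 := by
    intro x hx y hy
    have h1 := (Complex.abs_im_le_norm _).trans_lt (hnear (x, y) ⟨hx, hy⟩)
    rw [hval _ ⟨hx, hy⟩] at h1
    simpa [Complex.exp_im] using h1
  have m1 : (1 : ℝ) ∈ Icc (-1 : ℝ) 1 := right_mem_Icc.2 h11
  have m2 : (-1 : ℝ) ∈ Icc (-1 : ℝ) 1 := left_mem_Icc.2 h11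
  obtain ⟨k0, hk0⟩ := exists_int_abs_sub_lt_of_cos_pos (θ := fun y => θ 1 y) (c := 0) h11
    (hθx 1).continuousOn (by
      intro y hy
      have h1 := (abs_lt.1 (hre 1 m1 y hy)).1
      rw [sub_zero]
      exact pos_of_mul_pos_right (by linarith) (Real.exp_pos _).le)
  obtain ⟨k1, hk1⟩ := exists_int_abs_sub_lt_of_cos_pos (θ := fun x => θ x 1)
    (c := 0 + Real.pi / 2) h11 (hθy 1).continuousOn (by
      intro x hx
      have h1 := (abs_lt.1 (him x hx 1 m1)).1
      rw [zero_add, Real.cos_sub_pi_div_two]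
      exact pos_of_mul_pos_right (by linarith) (Real.exp_pos _).le)
  obtain ⟨k2, hk2⟩ := exists_int_abs_sub_lt_of_cos_pos (θ := fun y => θ (-1) y)
    (c := 0 + Real.pi / 2 + Real.pi / 2) h11 (hθx (-1)).continuousOn (by
      intro y hy
      have h1 := (abs_lt.1 (hre (-1) m2 y hy)).2
      rw [zero_add, add_halves, Real.cos_sub_pi]
      refine pos_of_mul_pos_right (a := Real.exp (f (-1, y)).re) ?_ (Real.exp_pos _).le
      linarith)
  obtain ⟨k3, hk3⟩ := exists_int_abs_sub_lt_of_cos_pos (θ := fun x => θ x (-1))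
    (c := 0 + Real.pi / 2 + Real.pi / 2 + Real.pi / 2) h11 (hθy (-1)).continuousOn (by
      intro x hx
      have h1 := (abs_lt.1 (him x hx (-1) m2)).2
      rw [zero_add, add_halves, ← sub_sub, Real.cos_sub_pi_div_two, Real.sin_sub_pi]
      refine pos_of_mul_pos_right (a := Real.exp (f (x, -1)).re) ?_ (Real.exp_pos _).le
      linarith)
  have e1 := int_eq_of_abs_sub_lt (hk0 1 m1) (hk1 1 m1)
  have e2 := int_eq_of_abs_sub_lt (hk1 (-1) m2) (hk2 1 m1)
  have e3 := int_eq_of_abs_sub_lt (hk2 (-1) m2) (hk3 (-1) m2)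
  have e4 : k3 = k0 - 1 := by
    refine int_eq_of_abs_sub_lt (hk3 1 m1) ?_
    have h := hk0 (-1) m2
    have : θ 1 (-1) - (0 + Real.pi / 2 + Real.pi / 2 + Real.pi / 2 + Real.pi / 2)
        - 2 * Real.pi * ((k0 - 1 : ℤ) : ℝ) = θ 1 (-1) - 0 - 2 * Real.pi * k0 := by
      push_cast
      ring
    rw [this]
    exact h
  omega

theorem Circle.exists_ne_zero_near (g : C(Circle, ℂ)) {μ : ℝ} (hμ : 0 < μ) :
    ∃ g' : C(Circle, ℂ), (∀ w, g' w ≠ 0) ∧ ∀ w, ‖g' w - g w‖ < μ := by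
  have : Fact (0 < 2 * Real.pi) := ⟨Real.two_pi_pos⟩
  set e := AddCircle.homeomorphCircle' with he
  set g₁ : C(AddCircle (2 * Real.pi), ℂ) := g.comp ⟨e, e.continuous⟩ with hg₁
  have hmem : g₁ ∈ closure
      (Submodule.span ℂ (range (@fourier (2 * Real.pi))) : Set C(AddCircle (2 * Real.pi), ℂ)) := by
    rw [← Submodule.topologicalClosure_coe, span_fourier_closure_eq_top]
    trivial
  obtain ⟨p, hp, hpg⟩ := Metric.mem_closure_iff.1 hmem (μ / 2) (half_pos hμ)
  have hdiff : ContDiff ℝ 1 (fun t : ℝ => p (t : AddCircle (2 * Real.pi))) := by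
    refine Submodule.span_induction
      (p := fun q _ => ContDiff ℝ 1 (fun t : ℝ => q (t : AddCircle (2 * Real.pi))))
      ?_ ?_ ?_ ?_ hp
    · rintro _ ⟨n, rfl⟩
      simp only [fourier_coe_apply]
      have : ContDiff ℝ 1 (fun t : ℝ => (t : ℂ)) := Complex.ofRealCLM.contDiff
      exact ((contDiff_const.mul this).div_const _).cexp
    · exact contDiff_const
    · intro x y _ _ hx hy
      exact hx.add hy
    · intro a x _ hx
      exact contDiff_const.mul hx
  have hdense := hdiff.dense_compl_range_of_finrank_lt_finrank (by
    rw [Complex.finrank_real_complex, Module.finrank_self]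
    norm_num)
  obtain ⟨v, hv, hv'⟩ := Metric.mem_closure_iff.1 (hdense 0) (μ / 2) (half_pos hμ)
  rw [dist_zero_left] at hv'
  refine ⟨(p - ContinuousMap.const _ v).comp ⟨e.symm, e.symm.continuous⟩, fun w hw => ?_,
    fun w => ?_⟩
  · obtain ⟨t, ht⟩ := QuotientAddGroup.mk_surjective (e.symm w)
    refine hv ⟨t, ?_⟩
    simp only [ContinuousMap.comp_apply, ContinuousMap.coe_mk, ContinuousMap.sub_apply,
      ContinuousMap.const_apply, sub_eq_zero] at hw
    rw [← hw, ← ht]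
  · have h1 : ‖p (e.symm w) - g₁ (e.symm w)‖ < μ / 2 := by
      rw [← dist_eq_norm, dist_comm]
      exact (ContinuousMap.dist_apply_le_dist _).trans_lt hpg
    have h2 : g₁ (e.symm w) = g w := by simp [hg₁]
    rw [h2] at h1
    simp only [ContinuousMap.comp_apply, ContinuousMap.coe_mk, ContinuousMap.sub_apply,
      ContinuousMap.const_apply]
    calc ‖p (e.symm w) - v - g w‖ = ‖(p (e.symm w) - g w) - v‖ := by ring_nf
      _ ≤ ‖p (e.symm w) - g w‖ + ‖v‖ := norm_sub_le _ _
      _ < μ := by linarith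

theorem IsCompact.continuousOn_comp_invFunOn {X Y Z : Type*} [TopologicalSpace X] [Nonempty X]
    [TopologicalSpace Y] [T2Space Y] [TopologicalSpace Z] {K : Set X} (hK : IsCompact K)
    {f : X → Y} {g : X → Z} (hf : ContinuousOn f K) (hg : ContinuousOn g K)
    (hfg : ∀ x ∈ K, ∀ y ∈ K, f x = f y → g x = g y) :
    ContinuousOn (g ∘ Function.invFunOn f K) (f '' K) := by
  have hinv : ∀ x ∈ K, g (Function.invFunOn f K (f x)) = g x := fun x hx =>
    hfg _ (Function.invFunOn_mem ⟨x, hx, rfl⟩) _ hx (Function.invFunOn_eq ⟨x, hx, rfl⟩)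
  rw [continuousOn_iff_isClosed]
  intro t ht
  obtain ⟨u, hu, hut⟩ := continuousOn_iff_isClosed.1 hg t ht
  refine ⟨f '' (K ∩ u), ((hK.inter_right hu).image_of_continuousOn
    (hf.mono inter_subset_left)).isClosed, ?_⟩
  ext y
  constructor
  · rintro ⟨hy, x, hx, rfl⟩
    rw [mem_preimage, Function.comp_apply, hinv x hx] at hy
    have : x ∈ g ⁻¹' t ∩ K := ⟨hy, hx⟩
    rw [hut] at this
    exact ⟨⟨x, ⟨hx, this.1⟩, rfl⟩, x, hx, rfl⟩
  · rintro ⟨⟨x, ⟨hx, hxu⟩, rfl⟩, -⟩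
    have : x ∈ u ∩ K := ⟨hxu, hx⟩
    rw [← hut] at this
    refine ⟨?_, x, hx, rfl⟩
    rw [mem_preimage, Function.comp_apply, hinv x hx]
    exact this.1

theorem IsCompact.continuousOn_invFunOn {X Y : Type*} [TopologicalSpace X] [Nonempty X]
    [TopologicalSpace Y] [T2Space Y] {K : Set X} (hK : IsCompact K) {f : X → Y}
    (hf : ContinuousOn f K) (hinj : InjOn f K) :
    ContinuousOn (Function.invFunOn f K) (f '' K) :=
  hK.continuousOn_comp_invFunOn hf continuousOn_id hinj

/-- Invariance of domain in the plane, for the standard square and its centre. -/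
theorem image_square_mem_nhds {H : ℝ × ℝ → ℂ}
    (hH : ContinuousOn H (Icc (-1) 1 ×ˢ Icc (-1) 1))
    (hinj : InjOn H (Icc (-1) 1 ×ˢ Icc (-1) 1)) :
    H '' (Icc (-1) 1 ×ˢ Icc (-1) 1) ∈ 𝓝 (H (0, 0)) := by
  set Q : Set (ℝ × ℝ) := Icc (-1) 1 ×ˢ Icc (-1) 1 with hQ
  have hQc : IsCompact Q := isCompact_Icc.prod isCompact_Icc
  have h0Q : ((0 : ℝ), (0 : ℝ)) ∈ Q := by simp [hQ]
  set K := H '' Q with hK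
  have hKc : IsCompact K := hQc.image_of_continuousOn hH
  by_contra hnot
  set j : ℝ × ℝ → ℂ := fun q => (q.1 : ℂ) + q.2 * Complex.I with hj
  have hjc : Continuous j := by fun_prop
  obtain ⟨G, hG⟩ : ∃ G : C(ℂ, ℂ), ∀ q ∈ Q, G (H q) = j q := by
    have hcont : ContinuousOn (j ∘ Function.invFunOn H Q) K :=
      hjc.comp_continuousOn (hQc.continuousOn_invFunOn hH hinj)
    obtain ⟨G, hG⟩ := ContinuousMap.exists_restrict_eq hKc.isClosed
      (⟨K.domRestrict (j ∘ Function.invFunOn H Q),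
        continuousOn_iff_continuous_domRestrict.1 hcont⟩ : C(K, ℂ))
    refine ⟨G, fun q hq => ?_⟩
    have := DFunLike.congr_fun hG ⟨H q, mem_image_of_mem H hq⟩
    simpa [hinj.leftInvOn_invFunOn hq] using this
  have hGz : G (H (0, 0)) = 0 := by simp [hG _ h0Q, hj]
  obtain ⟨ε₀, hε₀, hG4⟩ := Metric.continuousAt_iff.1
    (G.continuous.continuousAt (x := H (0, 0))) (1 / 4) (by norm_num)
  set ε := ε₀ / 3 with hε
  have hεpos : 0 < ε := by positivity
  obtain ⟨c, hcz, hcK⟩ : ∃ c, dist c (H (0, 0)) < ε ∧ c ∉ K := by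
    by_contra! h
    exact hnot (Filter.mem_of_superset (Metric.ball_mem_nhds _ hεpos) h)
  have hsmall : ∀ y, dist y c ≤ ε → ‖G y‖ < 1 / 4 := by
    intro y hy
    have := hG4 (x := y) (by
      have := dist_triangle y c (H (0, 0))
      linarith)
    rwa [hGz, dist_zero_right] at this
  obtain ⟨μ, hμ, hμG⟩ : ∃ μ > 0, ∀ y ∈ K, ε ≤ dist y c → μ ≤ ‖G y‖ := by
    have hc : IsCompact (K ∩ {y | ε ≤ dist y c}) :=
      hKc.inter_right (isClosed_le continuous_const (by fun_prop))
    rcases (K ∩ {y | ε ≤ dist y c}).eq_empty_or_nonempty with he | hne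
    · refine ⟨1, one_pos, fun y hy hyc => ?_⟩
      have : y ∈ K ∩ {y | ε ≤ dist y c} := ⟨hy, hyc⟩
      rw [he] at this
      exact this.elim
    · obtain ⟨y₀, ⟨hy₀, hy₀c⟩, hmin⟩ := hc.exists_isMinOn hne
        (f := fun y => ‖G y‖) (by fun_prop)
      refine ⟨‖G y₀‖, norm_pos_iff.2 fun h0 => ?_, fun y hy hyc => hmin ⟨hy, hyc⟩⟩
      obtain ⟨q, hq, rfl⟩ := hy₀
      rw [hG q hq] at h0
      have hq0 : q = (0, 0) := by
        have h1 := congrArg Complex.re h0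
        have h2 := congrArg Complex.im h0
        simp [hj] at h1 h2
        exact Prod.ext h1 h2
      rw [hq0, mem_ofPred_eq, dist_comm] at hy₀c
      linarith
  set ν := min μ (1 / 4) with hν
  have hνpos : 0 < ν := lt_min hμ (by norm_num)
  obtain ⟨g', hg'0, hg'⟩ := Circle.exists_ne_zero_near
    ⟨fun w : Circle => G (c + ε * w), by fun_prop⟩ hνpos
  simp only [ContinuousMap.coe_mk] at hg'
  have hyc : ∀ y ∈ K, y - c ≠ 0 := by
    intro y hy h
    exact hcK ((sub_eq_zero.1 h) ▸ hy)
  set D : K → Circle := fun y => ⟨(y.1 - c) / ‖y.1 - c‖, by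
    simp [Submonoid.unitSphere, hyc y.1 y.2]⟩ with hD
  have hDc : Continuous D := by
    refine Continuous.subtype_mk ?_ _
    refine Continuous.div (by fun_prop) (by fun_prop) ?_
    intro y
    exact_mod_cast norm_ne_zero_iff.2 (hyc y.1 y.2)
  set Ψ : K → ℂ := fun y =>
    G (c + (max ε (dist y.1 c) : ℝ) * D y) + (g' (D y) - G (c + ε * D y)) with hΨ
  have hΨc : Continuous Ψ := by fun_prop
  have hfar : ∀ y : K, ε ≤ dist y.1 c → c + (max ε (dist y.1 c) : ℝ) * (D y : ℂ) = y.1 := by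
    intro y hy
    have hn : (‖y.1 - c‖ : ℂ) ≠ 0 := by exact_mod_cast norm_ne_zero_iff.2 (hyc y.1 y.2)
    rw [max_eq_right hy, dist_eq_norm]
    simp only [hD]
    field_simp
    ring
  have hΨ0 : ∀ y, Ψ y ≠ 0 := by
    intro y hy0
    rcases le_total ε (dist y.1 c) with h | h
    · simp only [hΨ] at hy0
      rw [hfar y h] at hy0
      have h1 := hμG y.1 y.2 h
      have h2 := hg' (D y)
      have h3 : G y.1 = -(g' (D y) - G (c + ε * D y)) := by linear_combination hy0
      rw [h3, norm_neg] at h1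
      exact absurd (h1.trans_lt h2) (not_lt.2 (min_le_left _ _))
    · simp only [hΨ, max_eq_left h] at hy0
      exact hg'0 (D y) (by linear_combination hy0)
  have hcirc : ∀ w : Circle, dist (c + ε * (w : ℂ)) c ≤ ε := by
    intro w
    simp [dist_eq_norm, abs_of_pos hεpos, Circle.norm_coe]
  have hΨG : ∀ y : K, ‖Ψ y - G y.1‖ < 1 := by
    intro y
    have h2 := hg' (D y)
    have h2' : ν ≤ 1 / 4 := min_le_right _ _
    rcases le_total ε (dist y.1 c) with h | h
    · simp only [hΨ]
      rw [hfar y h, add_sub_cancel_left]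
      linarith
    · simp only [hΨ, max_eq_left h]
      have h3 := hsmall _ (hcirc (D y))
      have h4 := hsmall _ h
      calc _ = ‖G (c + ε * D y) + (g' (D y) - G (c + ε * D y)) - G y.1‖ := rfl
        _ ≤ ‖G (c + ε * D y)‖ + ‖g' (D y) - G (c + ε * D y)‖ + ‖G y.1‖ :=
          (norm_sub_le _ _).trans (by gcongr; exact norm_add_le _ _)
        _ < 1 := by linarith
  classical
  set F : ℝ × ℝ → ℂ := fun q => if hq : q ∈ Q then Ψ ⟨H q, mem_image_of_mem H hq⟩ else 0 with hF
  have hFc : ContinuousOn F Q := by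
    rw [continuousOn_iff_continuous_domRestrict]
    have : Q.domRestrict F = fun q : Q => Ψ ⟨H q.1, mem_image_of_mem H q.2⟩ := by
      ext q
      simp [hF]
    rw [this]
    exact hΨc.comp (Continuous.subtype_mk (continuousOn_iff_continuous_domRestrict.1 hH) _)
  obtain ⟨q, hq, hq0⟩ := exists_eq_zero_of_near_inclusion hFc (by
    intro q hq
    have h1 := hΨG ⟨H q, mem_image_of_mem H hq⟩
    simp only [hG q hq] at h1
    simp only [hF, hQ] at *
    rw [dif_pos hq]
    exact h1)
  simp only [hF] at hq0
  rw [dif_pos hq] at hq0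
  exact hΨ0 _ hq0

/-- Invariance of domain for maps from a rectangle to a surface with boundary. -/
theorem image_rectangle_mem_nhds {S : Type*} [TopologicalSpace S]
    [ChartedSpace (EuclideanHalfSpace 2) S] {H : ℝ × ℝ → S} {a b c d : ℝ}
    (hH : ContinuousOn H (Icc a b ×ˢ Icc c d)) (hinj : InjOn H (Icc a b ×ˢ Icc c d))
    {q : ℝ × ℝ} (hq : q ∈ Ioo a b ×ˢ Ioo c d) :
    H '' (Icc a b ×ˢ Icc c d) ∈ 𝓝 (H q) := by
  set e := chartAt (EuclideanHalfSpace 2) (H q) with he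
  have hRq : Icc a b ×ˢ Icc c d ∈ 𝓝 q :=
    prod_mem_nhds (Icc_mem_nhds hq.1.1 hq.1.2) (Icc_mem_nhds hq.2.1 hq.2.2)
  have hes : e.source ∈ 𝓝 (H q) := chart_source_mem_nhds _ _
  obtain ⟨ε, hε, hball⟩ := Metric.nhds_basis_closedBall.mem_iff.1
    (Filter.inter_mem hRq ((hH.continuousAt hRq).preimage_mem_nhds hes))
  set L : ℝ × ℝ → ℝ × ℝ := fun s => (q.1 + ε * s.1, q.2 + ε * s.2) with hL
  have hLc : Continuous L := by fun_prop
  have hLm : ∀ s ∈ (Icc (-1) 1 ×ˢ Icc (-1) 1 : Set (ℝ × ℝ)), L s ∈ closedBall q ε := by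
    rintro ⟨s, t⟩ ⟨⟨h1, h2⟩, h3, h4⟩
    simp only at h1 h2 h3 h4
    rw [mem_closedBall, Prod.dist_eq, max_le_iff, Real.dist_eq, Real.dist_eq, abs_le, abs_le]
    simp only [hL]
    refine ⟨⟨?_, ?_⟩, ?_, ?_⟩ <;> nlinarith
  have hLi : Function.Injective L := by
    rintro ⟨s, t⟩ ⟨s', t'⟩ h
    simpa [hL, hε.ne'] using h
  set emb : EuclideanHalfSpace 2 → ℂ := fun y => (y.1 0 : ℂ) + y.1 1 * Complex.I with hemb
  have hembc : Continuous emb := by fun_prop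
  have hembi : Function.Injective emb := by
    intro y y' h
    have h1 := congrArg Complex.re h
    have h2 := congrArg Complex.im h
    simp [hemb] at h1 h2
    apply Subtype.ext
    ext i
    fin_cases i
    · exact h1
    · exact h2
  have hL0 : L (0, 0) = q := by simp [hL]
  have hcont : ContinuousOn (fun s => emb (e (H (L s)))) (Icc (-1) 1 ×ˢ Icc (-1) 1) :=
    hembc.comp_continuousOn (e.continuousOn.comp (hH.comp hLc.continuousOn
      fun s hs => (hball (hLm s hs)).1) fun s hs => (hball (hLm s hs)).2)
  have himg := image_square_mem_nhds hcont (by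
    intro s hs s' hs' h
    exact hLi (hinj (hball (hLm s hs)).1 (hball (hLm s' hs')).1
      (e.injOn (hball (hLm s hs)).2 (hball (hLm s' hs')).2 (hembi h))))
  simp only [hL0] at himg
  have hce : ContinuousAt (fun x => emb (e x)) (H q) :=
    hembc.continuousAt.comp (e.continuousAt (mem_chart_source _ _))
  filter_upwards [hce.preimage_mem_nhds himg, hes] with x hx hxs
  obtain ⟨s, hs, hsx⟩ := hx
  refine ⟨L s, (hball (hLm s hs)).1, ?_⟩
  exact e.injOn (hball (hLm s hs)).2 hxs (hembi hsx)

/-- A closed subset `K` of the unit interval containing the end points, such that `f` takes the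
same value at the two ends of every gap of `K`. -/
def IsShortcut {X : Type*} (f : ℝ → X) (K : Set ℝ) : Prop :=
  IsClosed K ∧ K ⊆ Icc 0 1 ∧ 0 ∈ K ∧ 1 ∈ K ∧
    ∀ c ∈ K, ∀ d ∈ K, c < d → Disjoint (Ioo c d) K → f c = f d

theorem IsShortcut.diff_Ioo {X : Type*} {f : ℝ → X} {K : Set ℝ} (hK : IsShortcut f K) {c d : ℝ}
    (hc : c ∈ K) (hd : d ∈ K) (hcd : f c = f d) : IsShortcut f (K \ Ioo c d) := by
  obtain ⟨h1, h2, h3, h4, h5⟩ := hK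
  refine ⟨h1.sdiff isOpen_Ioo, sdiff_subset.trans h2, ⟨h3, fun h => ?_⟩, ⟨h4, fun h => ?_⟩, ?_⟩
  · exact absurd (h2 hc).1 (not_le.2 h.1)
  · exact absurd (h2 hd).2 (not_le.2 h.2)
  · rintro c' ⟨hc', hc''⟩ d' ⟨hd', hd''⟩ hlt hdis
    by_cases hdK : Disjoint (Ioo c' d') K
    · exact h5 c' hc' d' hd' hlt hdK
    · obtain ⟨k, hk, hkK⟩ := Set.not_disjoint_iff.1 hdK
      have hkI : k ∈ Ioo c d := by
        by_contra hkn
        exact Set.disjoint_left.1 hdis hk ⟨hkK, hkn⟩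
      have e1 : c' ≤ c := by
        by_contra! h
        exact hc'' ⟨h, hk.1.trans hkI.2⟩
      have e2 : d ≤ d' := by
        by_contra! h
        exact hd'' ⟨hkI.1.trans hk.2, h⟩
      have e3 : c ≤ c' := by
        by_contra! h
        exact Set.disjoint_left.1 hdis ⟨h, hkI.1.trans hk.2⟩ ⟨hc, fun h => lt_irrefl _ h.1⟩
      have e4 : d' ≤ d := by
        by_contra! h
        exact Set.disjoint_left.1 hdis ⟨hk.1.trans hkI.2, h⟩ ⟨hd, fun h => lt_irrefl _ h.2⟩
      rw [le_antisymm e1 e3, le_antisymm e4 e2, hcd]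

theorem IsShortcut.sInter {X : Type*} [TopologicalSpace X] [T2Space X] {f : ℝ → X}
    (hf : Continuous f) {C : Set (Set ℝ)} (hne : C.Nonempty) (hchain : IsChain (· ⊆ ·) C)
    (hC : ∀ K ∈ C, IsShortcut f K) : IsShortcut f (⋂₀ C) := by
  obtain ⟨K₀, hK₀⟩ := hne
  refine ⟨isClosed_sInter fun K hK => (hC K hK).1,
    (sInter_subset_of_mem hK₀).trans (hC K₀ hK₀).2.1, fun K hK => (hC K hK).2.2.1,
    fun K hK => (hC K hK).2.2.2.1, fun c hc d hd hcd hdis => ?_⟩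
  have key : ∀ n : ℕ, ∃ c' d', dist c' c ≤ (d - c) / (n + 3) ∧ dist d' d ≤ (d - c) / (n + 3) ∧
      f c' = f d' := by
    intro n
    have hdc : 0 < d - c := sub_pos.2 hcd
    set ε := (d - c) / (n + 3) with hε
    have hεpos : 0 < ε := by positivity
    have hε3 : ε ≤ (d - c) / 3 := by
      rw [hε]
      gcongr
      linarith [(Nat.cast_nonneg n : (0 : ℝ) ≤ n)]
    obtain ⟨K, hK, hKdis⟩ : ∃ K ∈ C, Icc (c + ε) (d - ε) ∩ K = ∅ := by
      by_contra! hall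
      have : Nonempty C := ⟨⟨K₀, hK₀⟩⟩
      have := IsCompact.nonempty_iInter_of_directed_nonempty_isCompact_isClosed
        (fun K : C => Icc (c + ε) (d - ε) ∩ K.1) (by
          intro K K'
          rcases hchain.total K.2 K'.2 with h | h
          · exact ⟨K, Subset.rfl, inter_subset_inter_right _ h⟩
          · exact ⟨K', inter_subset_inter_right _ h, Subset.rfl⟩)
        (fun K => hall K.1 K.2)
        (fun K => isCompact_Icc.inter_right (hC _ K.2).1)
        (fun K => isClosed_Icc.inter (hC _ K.2).1)
      obtain ⟨x, hx⟩ := this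
      rw [mem_iInter] at hx
      have h1 := (hx ⟨K₀, hK₀⟩).1
      exact Set.disjoint_left.1 hdis
        (⟨by linarith [h1.1], by linarith [h1.2]⟩ : x ∈ Ioo c d) fun K hK => (hx ⟨K, hK⟩).2
    obtain ⟨h1, -, -, -, h5⟩ := hC K hK
    have cA : IsCompact (K ∩ Icc c (c + ε)) := isCompact_Icc.inter_left h1
    have cB : IsCompact (K ∩ Icc (d - ε) d) := isCompact_Icc.inter_left h1
    have nA : (K ∩ Icc c (c + ε)).Nonempty := ⟨c, hc K hK, le_rfl, by linarith⟩
    have nB : (K ∩ Icc (d - ε) d).Nonempty := ⟨d, hd K hK, by linarith, le_rfl⟩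
    have mA := cA.sSup_mem nA
    have mB := cB.sInf_mem nB
    refine ⟨_, _, ?_, ?_, h5 _ mA.1 _ mB.1 ?_ ?_⟩
    · rw [Real.dist_eq, abs_le]
      exact ⟨by linarith [mA.2.1], by linarith [mA.2.2]⟩
    · rw [Real.dist_eq, abs_le]
      exact ⟨by linarith [mB.2.1], by linarith [mB.2.2]⟩
    · linarith [mA.2.2, mB.2.1]
    · rw [Set.disjoint_left]
      rintro k ⟨hk1, hk2⟩ hkK
      have e1 : c + ε < k := by
        by_contra! h
        exact absurd (le_csSup cA.bddAbove ⟨hkK, mA.2.1.trans hk1.le, h⟩) (not_le.2 hk1)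
      have e2 : k < d - ε := by
        by_contra! h
        exact absurd (csInf_le cB.bddBelow ⟨hkK, h, hk2.le.trans mB.2.2⟩) (not_le.2 hk2)
      exact (hKdis ▸ (⟨⟨e1.le, e2.le⟩, hkK⟩ : k ∈ Icc (c + ε) (d - ε) ∩ K) : k ∈ (∅ : Set ℝ))
  choose c' d' hc' hd' hfe using key
  have hlim : Tendsto (fun n : ℕ => (d - c) / ((n : ℝ) + 3)) atTop (𝓝 0) :=
    tendsto_const_nhds.div_atTop (tendsto_atTop_add_const_right _ _ tendsto_natCast_atTop_atTop)
  have l1 : Tendsto c' atTop (𝓝 c) := tendsto_iff_dist_tendsto_zero.2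
    (squeeze_zero (fun _ => dist_nonneg) hc' hlim)
  have l2 : Tendsto d' atTop (𝓝 d) := tendsto_iff_dist_tendsto_zero.2
    (squeeze_zero (fun _ => dist_nonneg) hd' hlim)
  refine tendsto_nhds_unique ((hf.tendsto c).comp l1) ?_
  rw [show f ∘ c' = f ∘ d' from funext hfe]
  exact (hf.tendsto d).comp l2

/-- A path can be shortened to a path all of whose fibres are intervals. -/
theorem exists_shortcut {X : Type*} [MetricSpace X] {f : ℝ → X} (hf : Continuous f) :
    ∃ g : ℝ → X, ContinuousOn g (Icc 0 1) ∧ g 0 = f 0 ∧ g 1 = f 1 ∧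
      g '' Icc 0 1 ⊆ f '' Icc 0 1 ∧
      ∀ x ∈ Icc (0 : ℝ) 1, ∀ y ∈ Icc (0 : ℝ) 1, ∀ z ∈ Icc x y, g x = g y → g z = g x := by
  have hIcc : IsShortcut f (Icc 0 1) := by
    refine ⟨isClosed_Icc, Subset.rfl, by simp, by simp, fun c hc d hd hcd hdis => ?_⟩
    obtain ⟨k, hk⟩ := exists_between hcd
    exact (Set.disjoint_left.1 hdis hk ⟨hc.1.trans hk.1.le, hk.2.le.trans hd.2⟩).elim
  obtain ⟨K, hKmin⟩ := zorn_superset {K | IsShortcut f K} (by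
    intro C hC hchain
    rcases C.eq_empty_or_nonempty with rfl | hne
    · exact ⟨Icc 0 1, hIcc, by simp⟩
    · exact ⟨⋂₀ C, IsShortcut.sInter hf hne hchain hC, fun K hK => sInter_subset_of_mem hK⟩)
  have hK : IsShortcut f K := hKmin.prop
  have hgap : ∀ c ∈ K, ∀ d ∈ K, f c = f d → Disjoint (Ioo c d) K := by
    intro c hc d hd hcd
    have := hKmin.le_of_le (hK.diff_Ioo hc hd hcd) sdiff_subset
    rw [Set.disjoint_right]
    exact fun k hk => (this hk).2
  obtain ⟨h1, h2, h3, h4, h5⟩ := hK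
  set s : ℝ → ℝ := fun x => sSup (K ∩ Icc 0 x) with hs
  have hcpt : ∀ x, IsCompact (K ∩ Icc 0 x) := fun x => isCompact_Icc.inter_left h1
  have hsm : ∀ x, 0 ≤ x → s x ∈ K ∩ Icc 0 x := fun x hx =>
    (hcpt x).sSup_mem ⟨0, h3, le_rfl, hx⟩
  have hsle : ∀ x, ∀ k ∈ K, k ≤ x → k ≤ s x := fun x k hk hkx =>
    le_csSup (hcpt x).bddAbove ⟨hk, (h2 hk).1, hkx⟩
  have hsK : ∀ x ∈ K, s x = x := fun x hx =>
    le_antisymm (hsm x (h2 hx).1).2.2 (hsle x x hx le_rfl)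
  have hcmp : ∀ x ∈ Icc (0 : ℝ) 1, ∀ y ∈ Icc (0 : ℝ) 1, x ≤ y →
      ∃ k ∈ Icc x y, ∃ l ∈ Icc x y, dist (f (s x)) (f (s y)) = dist (f k) (f l) := by
    intro x hx y hy hxy
    by_cases hdis : s y < x
    · have : s x = s y := le_antisymm
        (hsle y _ (hsm x hx.1).1 ((hsm x hx.1).2.2.trans hxy))
        (hsle x _ (hsm y hy.1).1 hdis.le)
      exact ⟨x, ⟨le_rfl, hxy⟩, x, ⟨le_rfl, hxy⟩, by rw [this, dist_self, dist_self]⟩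
    · rw [not_lt] at hdis
      have cB : IsCompact (K ∩ Icc x 1) := isCompact_Icc.inter_left h1
      have mB := cB.sInf_mem ⟨1, h4, hx.2, le_rfl⟩
      set k := sInf (K ∩ Icc x 1) with hk
      have hky : k ≤ y :=
        (csInf_le cB.bddBelow ⟨(hsm y hy.1).1, hdis, (h2 (hsm y hy.1).1).2⟩).trans
          (hsm y hy.1).2.2
      refine ⟨k, ⟨mB.2.1, hky⟩, s y, ⟨hdis, (hsm y hy.1).2.2⟩, ?_⟩
      congr 1
      rcases ((hsm x hx.1).2.2.trans mB.2.1).eq_or_lt with h | h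
      · rw [h]
      · refine h5 _ (hsm x hx.1).1 _ mB.1 h (Set.disjoint_left.2 ?_)
        rintro t ⟨ht1, ht2⟩ htK
        rcases le_total t x with htx | htx
        · exact absurd (hsle x t htK htx) (not_le.2 ht1)
        · exact absurd (csInf_le cB.bddBelow ⟨htK, htx, (h2 htK).2⟩) (not_le.2 ht2)
  refine ⟨fun x => f (s x), ?_, by simp only [hsK 0 h3], by simp only [hsK 1 h4], ?_, ?_⟩
  · have hu := isCompact_Icc.uniformContinuousOn_of_continuous
      (hf.continuousOn (s := Icc (0 : ℝ) 1))
    refine UniformContinuousOn.continuousOn (Metric.uniformContinuousOn_iff.2 fun ε hε => ?_)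
    obtain ⟨δ, hδ, hδf⟩ := Metric.uniformContinuousOn_iff.1 hu ε hε
    have main : ∀ x ∈ Icc (0 : ℝ) 1, ∀ y ∈ Icc (0 : ℝ) 1, x ≤ y → dist x y < δ →
        dist (f (s x)) (f (s y)) < ε := by
      intro x hx y hy hxy hd
      obtain ⟨k, hk, l, hl, he⟩ := hcmp x hx y hy hxy
      rw [he]
      exact hδf k ⟨hx.1.trans hk.1, hk.2.trans hy.2⟩ l ⟨hx.1.trans hl.1, hl.2.trans hy.2⟩
        ((Real.dist_le_of_mem_Icc hk hl).trans_lt (by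
          rwa [Real.dist_eq, abs_sub_comm, abs_of_nonneg (sub_nonneg.2 hxy)] at hd))
    refine ⟨δ, hδ, fun x hx y hy hd => ?_⟩
    rcases le_total x y with h | h
    · exact main x hx y hy h hd
    · rw [dist_comm]
      exact main y hy x hx h (by rwa [dist_comm])
  · rintro _ ⟨x, hx, rfl⟩
    exact ⟨s x, h2 (hsm x hx.1).1, rfl⟩
  · intro x hx y hy z hz he
    have e1 : s x ≤ s z := hsle z _ (hsm x hx.1).1 ((hsm x hx.1).2.2.trans hz.1)
    have hz0 : 0 ≤ z := hx.1.trans hz.1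
    have e2 : s z ≤ s y := hsle y _ (hsm z hz0).1 ((hsm z hz0).2.2.trans hz.2)
    have hd := hgap _ (hsm x hx.1).1 _ (hsm y hy.1).1 he
    rcases e1.eq_or_lt with h | h
    · simp only [h]
    · rcases e2.eq_or_lt with h' | h'
      · simp only [h', he]
      · exact (Set.disjoint_left.1 hd ⟨h, h'⟩ (hsm z hz0).1).elim

/-- A path with distinct end points contains an arc with the same end points. -/
theorem exists_arc_of_path {X : Type*} [MetricSpace X] {f : ℝ → X} (hf : Continuous f)
    (hne : f 0 ≠ f 1) :
    ∃ γ : ℝ → X, ContinuousOn γ (Icc 0 1) ∧ InjOn γ (Icc 0 1) ∧ γ 0 = f 0 ∧ γ 1 = f 1 ∧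
      γ '' Icc 0 1 ⊆ f '' Icc 0 1 := by
  obtain ⟨g, hgc, hg0, hg1, hgf, hfib⟩ := exists_shortcut hf
  set p : ℝ → ℝ := fun x => max 0 (min 1 x) with hp
  have hpm : ∀ x, p x ∈ Icc (0 : ℝ) 1 := fun x =>
    ⟨le_max_left _ _, max_le zero_le_one (min_le_left _ _)⟩
  have hpid : ∀ x ∈ Icc (0 : ℝ) 1, p x = x := fun x hx => by
    simp [hp, min_eq_right hx.2, max_eq_right hx.1]
  have hgp : Continuous fun x => g (p x) :=
    hgc.comp_continuous (by fun_prop) hpm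
  set G : ℝ × ℝ → ℝ → ℝ := fun z t => dist (g (p (z.1 + t * max (z.2 - z.1) 0))) (g (p z.1))
    with hG
  have hGc : Continuous fun q : (ℝ × ℝ) × ℝ => G q.1 q.2 :=
    Continuous.dist (hgp.comp (by fun_prop)) (hgp.comp (by fun_prop))
  set M : ℝ × ℝ → ℝ := fun z => sSup (G z '' Icc 0 1) with hM
  have hMc : Continuous M := isCompact_Icc.continuous_sSup hGc
  have hGb : ∀ z, BddAbove (G z '' Icc 0 1) := fun z =>
    (isCompact_Icc.image (hGc.comp (by fun_prop : Continuous fun t => (z, t)))).bddAbove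
  have hMle : ∀ {s x y}, (∀ t ∈ Icc (0 : ℝ) 1, ∃ t' ∈ Icc (0 : ℝ) 1, G (s, x) t = G (s, y) t') →
      M (s, x) ≤ M (s, y) := by
    intro s x y h
    refine csSup_le (by simp) ?_
    rintro _ ⟨t, ht, rfl⟩
    obtain ⟨t', ht', he⟩ := h t ht
    rw [he]
    exact le_csSup (hGb _) ⟨t', ht', rfl⟩
  have hGw : ∀ {s x z}, s ≤ z → z ≤ x → ∃ t ∈ Icc (0 : ℝ) 1,
      G (s, x) t = dist (g (p z)) (g (p s)) := by
    intro s x z hs hz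
    rcases (hs.trans hz).eq_or_lt with h | h
    · have hzs : z = s := le_antisymm (h ▸ hz) hs
      exact ⟨0, by simp, by simp [hG, hzs]⟩
    · refine ⟨(z - s) / (x - s), ⟨div_nonneg (by linarith) (by linarith),
        (div_le_one (by linarith)).2 (by linarith)⟩, ?_⟩
      simp only [hG]
      rw [max_eq_left (by linarith), div_mul_cancel₀ _ (by linarith), add_sub_cancel]
  have hGz : ∀ {s x t}, t ∈ Icc (0 : ℝ) 1 → s ≤ x →
      ∃ z ∈ Icc s x, G (s, x) t = dist (g (p z)) (g (p s)) := by
    intro s x t ht hsx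
    refine ⟨s + t * max (x - s) 0, ?_, rfl⟩
    rw [max_eq_left (by linarith)]
    constructor <;> nlinarith [ht.1, ht.2]
  have hM0 : ∀ {s x}, x ≤ s → M (s, x) = 0 := by
    intro s x h
    have : G (s, x) '' Icc 0 1 = {0} := by
      have : G (s, x) = fun _ => 0 := by
        funext t
        simp only [hG]
        rw [max_eq_right (by linarith), mul_zero, add_zero, dist_self]
      rw [this]
      exact Set.Nonempty.image_const ⟨0, by simp⟩ _
    simp only [hM, this, csSup_singleton]
  have hMnn : ∀ s x, 0 ≤ M (s, x) := by
    intro s x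
    refine le_csSup (hGb _) ⟨0, by simp, by simp [hG]⟩
  have hMmono : ∀ {s x y}, x ≤ y → M (s, x) ≤ M (s, y) := by
    intro s x y hxy
    rcases le_total x s with h | h
    · rw [hM0 h]
      exact hMnn _ _
    · refine hMle fun t ht => ?_
      obtain ⟨z, hz, he⟩ := hGz ht h
      obtain ⟨t', ht', he'⟩ := hGw hz.1 (hz.2.trans hxy)
      exact ⟨t', ht', he.trans he'.symm⟩
  have hMeq : ∀ {s x y}, s ∈ Icc (0 : ℝ) 1 → x ∈ Icc (0 : ℝ) 1 → y ∈ Icc (0 : ℝ) 1 → x ≤ y →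
      g x = g y → M (s, x) = M (s, y) := by
    intro s x y hs hx hy hxy he
    refine le_antisymm (hMmono hxy) ?_
    rcases le_total y s with h | h
    · rw [hM0 h, hM0 (hxy.trans h)]
    refine hMle fun t ht => ?_
    obtain ⟨z, hz, hGe⟩ := hGz ht h
    have hz01 : z ∈ Icc (0 : ℝ) 1 := ⟨hs.1.trans hz.1, hz.2.trans hy.2⟩
    rcases le_total z x with hzx | hzx
    · obtain ⟨t', ht', he'⟩ := hGw hz.1 hzx
      exact ⟨t', ht', hGe.trans he'.symm⟩
    · rcases le_total s x with hsx | hsx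
      · obtain ⟨t', ht', he'⟩ := hGw hsx le_rfl
        refine ⟨t', ht', hGe.trans (Eq.trans ?_ he'.symm)⟩
        rw [hpid z hz01, hpid x hx, hfib x hx y hy z ⟨hzx, hz.2⟩ he]
      · refine ⟨0, by simp, hGe.trans ?_⟩
        rw [hpid z hz01, hpid s hs, hfib x hx y hy z ⟨hzx, hz.2⟩ he,
          hfib x hx y hy s ⟨hsx, h⟩ he, dist_self]
        simp [hG]
  set m : ℝ → ℝ := fun x => ∫ s in (0 : ℝ)..1, M (s, x) with hm
  have hmc : Continuous m :=
    intervalIntegral.continuous_parametric_intervalIntegral_of_continuous'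
      (by fun_prop : Continuous (Function.uncurry fun x s => M (s, x))) 0 1
  have hmlt : ∀ x ∈ Icc (0 : ℝ) 1, ∀ y ∈ Icc (0 : ℝ) 1, x < y → g x ≠ g y → m x < m y := by
    intro x hx y hy hxy hxyg
    refine intervalIntegral.integral_lt_integral_of_continuousOn_of_le_of_exists_lt one_pos
      (by fun_prop) (by fun_prop) (fun s _ => hMmono hxy.le) ⟨x, hx, ?_⟩
    rw [hM0 le_rfl]
    obtain ⟨t, ht, he⟩ := hGw hxy.le le_rfl
    refine lt_of_lt_of_le ?_ (le_csSup (hGb _) ⟨t, ht, rfl⟩)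
    rw [he, hpid x hx, hpid y hy]
    exact dist_pos.2 hxyg.symm
  have hmeq : ∀ x ∈ Icc (0 : ℝ) 1, ∀ y ∈ Icc (0 : ℝ) 1, g x = g y → m x = m y := by
    have main : ∀ x ∈ Icc (0 : ℝ) 1, ∀ y ∈ Icc (0 : ℝ) 1, x ≤ y → g x = g y → m x = m y := by
      intro x hx y hy hxy he
      refine intervalIntegral.integral_congr fun s hs => ?_
      rw [uIcc_of_le zero_le_one] at hs
      exact hMeq hs hx hy hxy he
    intro x hx y hy he
    rcases le_total x y with h | h
    · exact main x hx y hy h he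
    · exact (main y hy x hx h he.symm).symm
  have hmg : ∀ x ∈ Icc (0 : ℝ) 1, ∀ y ∈ Icc (0 : ℝ) 1, m x = m y → g x = g y := by
    intro x hx y hy he
    by_contra hne
    rcases lt_trichotomy x y with h | h | h
    · exact (hmlt x hx y hy h hne).ne he
    · exact hne (by rw [h])
    · exact (hmlt y hy x hx h (Ne.symm hne)).ne he.symm
  have h00 : (0 : ℝ) ∈ Icc (0 : ℝ) 1 := by simp
  have h11 : (1 : ℝ) ∈ Icc (0 : ℝ) 1 := by simp
  have hm01 : m 0 < m 1 := hmlt 0 h00 1 h11 one_pos (by rwa [hg0, hg1])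
  set n : ℝ → ℝ := fun x => (m x - m 0) / (m 1 - m 0) with hn
  have hnc : Continuous n := by fun_prop
  have hnm : ∀ x y, n x = n y ↔ m x = m y := by
    intro x y
    simp only [hn]
    rw [div_left_inj' (sub_pos.2 hm01).ne', sub_left_inj]
  have hn0 : n 0 = 0 := by simp [hn]
  have hn1 : n 1 = 1 := by simp [hn, (sub_pos.2 hm01).ne']
  have himg : Icc (0 : ℝ) 1 ⊆ n '' Icc 0 1 := by
    have := intermediate_value_Icc zero_le_one hnc.continuousOn
    rwa [hn0, hn1] at this
  have hinv : ∀ x ∈ Icc (0 : ℝ) 1, g (Function.invFunOn n (Icc 0 1) (n x)) = g x := fun x hx =>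
    hmg _ (Function.invFunOn_mem ⟨x, hx, rfl⟩) _ hx
      ((hnm _ _).1 (Function.invFunOn_eq ⟨x, hx, rfl⟩))
  refine ⟨g ∘ Function.invFunOn n (Icc 0 1),
    (isCompact_Icc.continuousOn_comp_invFunOn hnc.continuousOn hgc
      fun x hx y hy h => hmg x hx y hy ((hnm _ _).1 h)).mono himg, ?_, ?_, ?_, ?_⟩
  · intro u hu v hv he
    obtain ⟨x, hx, rfl⟩ := himg hu
    obtain ⟨y, hy, rfl⟩ := himg hv
    simp only [Function.comp_apply, hinv x hx, hinv y hy] at he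
    exact (hnm _ _).2 (hmeq x hx y hy he)
  · have := hinv 0 h00
    rw [hn0] at this
    exact this.trans hg0
  · have := hinv 1 h11
    rw [hn1] at this
    exact this.trans hg1
  · rintro _ ⟨u, hu, rfl⟩
    obtain ⟨x, hx, rfl⟩ := himg hu
    refine hgf ⟨x, hx, (hinv x hx).symm⟩

namespace IsFlow

variable {X : Type*} [MetricSpace X] {φ : ℝ → X → X}

theorem map_zero (hφ : IsFlow φ) (x : X) : φ 0 x = x := hφ.2.1 x

theorem map_map (hφ : IsFlow φ) (s t : ℝ) (x : X) : φ s (φ t x) = φ (s + t) x := hφ.2.2 s t x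

theorem continuous (hφ : IsFlow φ) {Y : Type*} [TopologicalSpace Y] {f : Y → ℝ} {g : Y → X}
    (hf : Continuous f) (hg : Continuous g) : Continuous fun y => φ (f y) (g y) :=
  hφ.1.comp (hf.prodMk hg)

theorem continuousOn (hφ : IsFlow φ) {Y : Type*} [TopologicalSpace Y] {f : Y → ℝ} {g : Y → X}
    {s : Set Y} (hf : ContinuousOn f s) (hg : ContinuousOn g s) :
    ContinuousOn (fun y => φ (f y) (g y)) s :=
  hφ.1.comp_continuousOn (hf.prodMk hg)

/-- `Y` is a local section on the open set `O`, with arrival time `σ` and time scale `r`. -/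
structure LocalSection (φ : ℝ → X → X) (z : X) (r : ℝ) (Y O : Set X) (σ : X → ℝ) : Prop where
  isOpen : IsOpen O
  mem : z ∈ O
  continuousOn : ContinuousOn σ O
  map_self : σ z = 0
  abs_lt : ∀ x ∈ O, |σ x| < r
  mem_iff : ∀ x ∈ O, ∀ s, |s| ≤ 3 * r → (φ s x ∈ Y ↔ s = σ x)

/-- A flow has small local sections through each of its regular points. -/
theorem exists_localSection (hφ : IsFlow φ) {z : X} (hz : ∃ t, φ t z ≠ z) {r₀ : ℝ}
    (hr₀ : 0 < r₀) : ∃ r, 0 < r ∧ r ≤ r₀ ∧ ∃ Y O σ, LocalSection φ z r Y O σ := by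
  obtain ⟨τ, hτz⟩ := hz
  set f : X → ℝ → ℝ := fun x u => dist (φ u x) z with hf
  have hfc : Continuous (Function.uncurry f) :=
    (hφ.continuous continuous_snd continuous_fst).dist continuous_const
  have hfx : ∀ x, Continuous (f x) := fun x => hfc.comp (by fun_prop : Continuous fun u => (x, u))
  set F : X → ℝ := fun x => ∫ u in (0 : ℝ)..τ, f x u with hF
  have hFc : Continuous F :=
    intervalIntegral.continuous_parametric_intervalIntegral_of_continuous' hfc 0 τ
  set a : X → ℝ := fun x => f x τ - f x 0 with ha
  have hac : Continuous a :=
    (hfc.comp (by fun_prop : Continuous fun x => (x, τ))).sub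
      (hfc.comp (by fun_prop : Continuous fun x => (x, (0 : ℝ))))
  have haz : 0 < a z := by
    simp only [ha, hf, hφ.map_zero, dist_self, sub_zero]
    exact dist_pos.2 hτz
  have hFφ : ∀ x t, F (φ t x) = (∫ u in (0 : ℝ)..(t + τ), f x u) - ∫ u in (0 : ℝ)..t, f x u := by
    intro x t
    rw [intervalIntegral.integral_interval_sub_left ((hfx x).intervalIntegrable _ _)
      ((hfx x).intervalIntegrable _ _)]
    have := intervalIntegral.integral_comp_add_right (a := 0) (b := τ) (f x) t
    rw [zero_add, add_comm τ t] at this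
    rw [← this]
    simp only [hF, hf, hφ.map_map]
  have hder : ∀ x t, HasDerivAt (fun t => F (φ t x)) (a (φ t x)) t := by
    intro x t
    have hd : ∀ b, HasDerivAt (fun b => ∫ u in (0 : ℝ)..b, f x u) (f x b) b := fun b =>
      intervalIntegral.integral_hasDerivAt_right ((hfx x).intervalIntegrable _ _)
        (hfx x).stronglyMeasurable.stronglyMeasurableAtFilter (hfx x).continuousAt
    have h1 := ((hd (t + τ)).comp_add_const t τ).sub (hd t)
    have h2 : a (φ t x) = f x (t + τ) - f x t := by
      simp only [ha, hf, hφ.map_map, zero_add, add_comm τ t]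
    rw [h2, show (fun t => F (φ t x)) = _ from funext (hFφ x)]
    exact h1
  have hev : ∀ᶠ q : ℝ × X in 𝓝 (0, z), 0 < a (φ q.1 q.2) := by
    have : ContinuousAt (fun q : ℝ × X => a (φ q.1 q.2)) (0, z) :=
      (hac.comp hφ.1).continuousAt
    refine this.eventually (lt_mem_nhds ?_)
    simpa only [hφ.map_zero] using haz
  obtain ⟨e, he, hball⟩ := Metric.eventually_nhds_iff_ball.1 hev
  set r := min r₀ (e / 4) with hr
  have hrpos : 0 < r := lt_min hr₀ (by positivity)
  have hpos : ∀ x ∈ ball z e, ∀ t, |t| < 4 * r → 0 < a (φ t x) := by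
    intro x hx t ht
    refine hball (t, x) ?_
    rw [mem_ball, Prod.dist_eq, max_lt_iff, dist_zero_right, Real.norm_eq_abs]
    exact ⟨ht.trans_le (by linarith [min_le_right r₀ (e / 4)]), hx⟩
  have hmono : ∀ x ∈ ball z e, StrictMonoOn (fun t => F (φ t x)) (Icc (-(4 * r)) (4 * r)) := by
    intro x hx
    refine strictMonoOn_of_deriv_pos (convex_Icc _ _)
      (fun t _ => (hder x t).continuousAt.continuousWithinAt) fun t ht => ?_
    rw [interior_Icc] at ht
    rw [(hder x t).deriv]
    exact hpos x hx t (abs_lt.2 ht)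
  have hFt : ∀ t, Continuous fun x => F (φ t x) := fun t =>
    hFc.comp (hφ.continuous continuous_const continuous_id)
  set O : Set X := ball z e ∩ ({x | F (φ (-r) x) < F z} ∩ {x | F z < F (φ r x)}) with hO
  have hzmono := hmono z (mem_ball_self he)
  have hOo : IsOpen O := isOpen_ball.inter
    ((isOpen_lt (hFt _) continuous_const).inter (isOpen_lt continuous_const (hFt _)))
  have hex : ∀ x ∈ O, ∃ t, t ∈ Ioo (-r) r ∧ F (φ t x) = F z := by
    intro x hx
    have hc : Continuous fun t => F (φ t x) := hFc.comp (hφ.continuous continuous_id continuous_const)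
    exact intermediate_value_Ioo (by linarith : -r ≤ r) hc.continuousOn ⟨hx.2.1, hx.2.2⟩
  classical
  choose! σ hσ hσF using hex
  have huniq : ∀ x ∈ O, ∀ s, |s| ≤ 3 * r → F (φ s x) = F z → s = σ x := by
    intro x hx s hs he
    rw [abs_le] at hs
    refine (hmono x hx.1).injOn ⟨by linarith, by linarith⟩ ?_ (he.trans (hσF x hx).symm)
    exact ⟨by linarith [(hσ x hx).1], by linarith [(hσ x hx).2]⟩
  have hzO : z ∈ O := by
    refine ⟨mem_ball_self he, ?_, ?_⟩
    · have := hzmono (a := -r) (b := 0) ⟨by linarith, by linarith⟩ ⟨by linarith, by linarith⟩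
        (by linarith)
      simpa [hφ.map_zero] using this
    · have := hzmono (a := 0) (b := r) ⟨by linarith, by linarith⟩ ⟨by linarith, by linarith⟩
        (by linarith)
      simpa [hφ.map_zero] using this
  refine ⟨r, hrpos, min_le_left _ _, {x | F x = F z}, O, σ, ⟨hOo, hzO, ?_,
    (huniq z hzO 0 (by rw [abs_zero]; positivity) (by rw [hφ.map_zero])).symm,
    fun x hx => abs_lt.2 (hσ x hx), fun x hx s hs => ⟨huniq x hx s hs, ?_⟩⟩⟩
  · intro x hx
    rw [ContinuousWithinAt, Metric.tendsto_nhds]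
    intro ε hε
    set η := min ε r / 2 with hη
    have hηpos : 0 < η := half_pos (lt_min hε hrpos)
    have hηε : η < ε := (half_lt_self (lt_min hε hrpos)).trans_le (min_le_left _ _)
    have hηr : η < r := (half_lt_self (lt_min hε hrpos)).trans_le (min_le_right _ _)
    have hsx := hσ x hx
    have hl : F (φ (σ x - η) x) < F z := by
      rw [← hσF x hx]
      exact hmono x hx.1 ⟨by linarith [hsx.1], by linarith [hsx.2]⟩
        ⟨by linarith [hsx.1], by linarith [hsx.2]⟩ (by linarith)
    have hu : F z < F (φ (σ x + η) x) := by
      rw [← hσF x hx]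
      exact hmono x hx.1 ⟨by linarith [hsx.1], by linarith [hsx.2]⟩
        ⟨by linarith [hsx.1], by linarith [hsx.2]⟩ (by linarith)
    filter_upwards [self_mem_nhdsWithin,
      nhdsWithin_le_nhds ((hFt (σ x - η)).continuousAt.eventually (gt_mem_nhds hl)),
      nhdsWithin_le_nhds ((hFt (σ x + η)).continuousAt.eventually (lt_mem_nhds hu))]
      with y hy h1 h2
    have hsy := hσ y hy
    rw [← hσF y hy] at h1 h2
    have i1 := ((hmono y hy.1).lt_iff_lt ⟨by linarith [hsx.1], by linarith [hsx.2]⟩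
      ⟨by linarith [hsy.1], by linarith [hsy.2]⟩).1 h1
    have i2 := ((hmono y hy.1).lt_iff_lt ⟨by linarith [hsy.1], by linarith [hsy.2]⟩
      ⟨by linarith [hsx.1], by linarith [hsx.2]⟩).1 h2
    rw [Real.dist_eq, _root_.abs_lt]
    constructor <;> linarith
  · rintro rfl
    exact hσF x hx

end IsFlow

namespace IsFlow

variable {X : Type*} [MetricSpace X] {φ : ℝ → X → X} {z : X} {r : ℝ} {Y O : Set X} {σ : X → ℝ}

theorem LocalSection.pos (h : LocalSection φ z r Y O σ) : 0 < r :=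
  (abs_nonneg _).trans_lt (h.abs_lt z h.mem)

theorem LocalSection.eq_zero_of_mem (hφ : IsFlow φ) (h : LocalSection φ z r Y O σ) {x : X}
    (hx : x ∈ O ∩ Y) {s : ℝ} (hs : |s| ≤ 3 * r) (hsx : φ s x ∈ Y) : s = 0 := by
  have hr := h.pos
  rw [(h.mem_iff x hx.1 s hs).1 hsx]
  refine ((h.mem_iff x hx.1 0 (by rw [abs_zero]; positivity)).1 ?_).symm
  rw [hφ.map_zero]
  exact hx.2

theorem LocalSection.exists_ne (hφ : IsFlow φ) (h : LocalSection φ z r Y O σ) {x : X}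
    (hx : x ∈ O ∩ Y) : ∃ t, φ t x ≠ x := by
  by_contra! hfix
  have hr := h.pos
  have := h.eq_zero_of_mem hφ hx (s := r) (by rw [abs_of_pos hr]; linarith)
    (by rw [hfix]; exact hx.2)
  exact hr.ne' this

theorem LocalSection.proj_mem (h : LocalSection φ z r Y O σ) {x : X} (hx : x ∈ O) :
    φ (σ x) x ∈ Y :=
  (h.mem_iff x hx _ ((h.abs_lt x hx).le.trans (by linarith [h.pos]))).2 rfl

/-- An arc in the local section `O ∩ Y`. -/
structure SectionArc (O Y : Set X) (γ : ℝ → X) : Prop where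
  continuousOn : ContinuousOn γ (Icc 0 1)
  injOn : InjOn γ (Icc 0 1)
  mem : ∀ u ∈ Icc (0 : ℝ) 1, γ u ∈ O ∩ Y

theorem SectionArc.injOn_flow (hφ : IsFlow φ) (h : LocalSection φ z r Y O σ) {γ : ℝ → X}
    (hγ : SectionArc O Y γ) :
    InjOn (fun q : ℝ × ℝ => φ q.2 (γ q.1)) (Icc 0 1 ×ˢ Icc (-r) r) := by
  rintro ⟨u, s⟩ ⟨hu, hs⟩ ⟨u', s'⟩ ⟨hu', hs'⟩ he
  simp only at hu hs hu' hs' he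
  have h1 : φ (s - s') (γ u) = γ u' := by
    have := congrArg (φ (-s')) he
    rw [hφ.map_map, hφ.map_map, neg_add_cancel, hφ.map_zero] at this
    rwa [sub_eq_neg_add]
  have h2 : s - s' = 0 := h.eq_zero_of_mem hφ (hγ.mem u hu)
    (abs_le.2 ⟨by linarith [hs.1, hs'.2, h.pos], by linarith [hs.2, hs'.1, h.pos]⟩)
    (h1 ▸ (hγ.mem u' hu').2)
  rw [h2, hφ.map_zero] at h1
  exact Prod.ext (hγ.injOn hu hu' h1) (sub_eq_zero.1 h2)

theorem SectionArc.continuousOn_flow (hφ : IsFlow φ) {γ : ℝ → X} (hγ : SectionArc O Y γ) :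
    ContinuousOn (fun q : ℝ × ℝ => φ q.2 (γ q.1)) (Icc 0 1 ×ˢ Icc (-r) r) :=
  hφ.continuousOn continuousOn_snd (hγ.continuousOn.comp continuousOn_fst fun _ hq => hq.1)

theorem SectionArc.image_mem_nhds [ChartedSpace (EuclideanHalfSpace 2) X] (hφ : IsFlow φ)
    (h : LocalSection φ z r Y O σ) {γ : ℝ → X} (hγ : SectionArc O Y γ) {u : ℝ}
    (hu : u ∈ Ioo (0 : ℝ) 1) :
    (fun q : ℝ × ℝ => φ q.2 (γ q.1)) '' (Icc 0 1 ×ˢ Icc (-r) r) ∈ 𝓝 (γ u) := by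
  have := image_rectangle_mem_nhds (hγ.continuousOn_flow hφ) (hγ.injOn_flow hφ h)
    (q := (u, 0)) ⟨hu, by linarith [h.pos], h.pos⟩
  simpa only [hφ.map_zero] using this

/-- A flow box with cross section `h`, whose points are `φ (σ x) (h (π x))`. -/
structure FlowBox (φ : ℝ → X → X) (r : ℝ) (h : ℝ → X) (N : Set X) (π σ : X → ℝ) : Prop where
  isOpen : IsOpen N
  continuousOn_section : ContinuousOn h (Icc 0 1)
  exists_ne : ∀ u ∈ Icc (0 : ℝ) 1, ∃ t, φ t (h u) ≠ h u
  continuousOn_proj : ContinuousOn π N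
  continuousOn_time : ContinuousOn σ N
  proj_mem : ∀ x ∈ N, π x ∈ Icc (0 : ℝ) 1
  abs_le : ∀ x ∈ N, |σ x| ≤ r
  eq : ∀ x ∈ N, φ (σ x) (h (π x)) = x

theorem SectionArc.exists_flowBox (hφ : IsFlow φ) (h : LocalSection φ z r Y O σ) {γ : ℝ → X}
    (hγ : SectionArc O Y γ)
    (hz : (fun q : ℝ × ℝ => φ q.2 (γ q.1)) '' (Icc 0 1 ×ˢ Icc (-r) r) ∈ 𝓝 z) :
    ∃ N π τ, z ∈ N ∧ FlowBox φ r γ N π τ := by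
  set H : ℝ × ℝ → X := fun q => φ q.2 (γ q.1) with hH
  set K : Set (ℝ × ℝ) := Icc 0 1 ×ˢ Icc (-r) r with hK
  have hinv : ContinuousOn (Function.invFunOn H K) (H '' K) :=
    (isCompact_Icc.prod isCompact_Icc).continuousOn_invFunOn (hγ.continuousOn_flow hφ)
      (hγ.injOn_flow hφ h)
  have hex : ∀ x ∈ interior (H '' K), ∃ a ∈ K, H a = x := fun x hx =>
    (mem_image _ _ _).1 (interior_subset hx)
  have hmem : ∀ x ∈ interior (H '' K), Function.invFunOn H K x ∈ K := fun x hx =>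
    Function.invFunOn_mem (hex x hx)
  exact ⟨interior (H '' K), fun x => (Function.invFunOn H K x).1,
    fun x => (Function.invFunOn H K x).2, mem_interior_iff_mem_nhds.2 hz,
    ⟨isOpen_interior, hγ.continuousOn, fun u hu => h.exists_ne hφ (hγ.mem u hu),
      (continuous_fst.comp_continuousOn hinv).mono interior_subset,
      (continuous_snd.comp_continuousOn hinv).mono interior_subset,
      fun x hx => (hmem x hx).1, fun x hx => _root_.abs_le.2 (hmem x hx).2,
      fun x hx => Function.invFunOn_eq (hex x hx)⟩⟩

/-- Points close to `z` project to points of the section joined to `z` by short paths. -/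
theorem LocalSection.eventually_path [LocallyPathConnectedSpace X] (hφ : IsFlow φ)
    (h : LocalSection φ z r Y O σ) {U : Set X} (hU : U ∈ 𝓝 z) :
    ∀ᶠ x in 𝓝 z, x ∈ O ∧ ∃ f : ℝ → X, Continuous f ∧ f 0 = φ (σ x) x ∧ f 1 = z ∧
      ∀ t, f t ∈ O ∩ Y ∩ U := by
  have hO : O ∈ 𝓝 z := h.isOpen.mem_nhds h.mem
  have hρ : ContinuousOn (fun x => φ (σ x) x) O :=
    hφ.continuousOn h.continuousOn continuousOn_id
  have hρz : φ (σ z) z = z := by rw [h.map_self, hφ.map_zero]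
  have hV₀ : (fun x => φ (σ x) x) ⁻¹' (O ∩ U) ∈ 𝓝 z := by
    refine (hρ.continuousAt hO).preimage_mem_nhds ?_
    rw [hρz]
    exact inter_mem hO hU
  obtain ⟨V, ⟨hVn, hVp⟩, hV⟩ :=
    (path_connected_basis z).mem_iff.1 (inter_mem hO hV₀)
  filter_upwards [hVn] with x hx
  obtain ⟨p, hp⟩ := hVp.joinedIn x hx z (mem_of_mem_nhds hVn)
  have hpV : ∀ t : ℝ, p.extend t ∈ V := by
    intro t
    have : p.extend t ∈ range p := by
      rw [← p.extend_range]
      exact mem_range_self t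
    obtain ⟨s, hs⟩ := this
    rw [← hs]
    exact hp s
  refine ⟨(hV hx).1, fun t => φ (σ (p.extend t)) (p.extend t), ?_, by simp, by simp [hρz],
    fun t => ⟨⟨(hV (hpV t)).2.1, h.proj_mem (hV (hpV t)).1⟩, (hV (hpV t)).2.2⟩⟩
  exact hρ.comp_continuous p.continuous_extend fun t => (hV (hpV t)).1

theorem SectionArc.append {γ η : ℝ → X} (hη : SectionArc O Y η) (hγ : SectionArc O Y γ)
    (heq : η 1 = γ 0) (hdis : ∀ u ∈ Ico (0 : ℝ) 1, η u ∉ γ '' Icc 0 1) :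
    SectionArc O Y fun t => if t ≤ 1 / 2 then η (2 * t) else γ (2 * t - 1) := by
  refine ⟨?_, ?_, ?_⟩
  · have h1 : Icc (0 : ℝ) 1 = Icc 0 (1 / 2) ∪ Icc (1 / 2) 1 :=
      (Icc_union_Icc_eq_Icc (by norm_num) (by norm_num)).symm
    rw [h1]
    refine ContinuousOn.union_of_isClosed ?_ ?_ isClosed_Icc isClosed_Icc
    · refine ContinuousOn.congr (f := fun t => η (2 * t)) (hη.continuousOn.comp (by fun_prop)
        fun t ht => ⟨by linarith [ht.1], by linarith [ht.2]⟩) fun t ht => if_pos ht.2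
    · refine ContinuousOn.congr (f := fun t => γ (2 * t - 1)) (hγ.continuousOn.comp (by fun_prop)
        fun t ht => ⟨by linarith [ht.1], by linarith [ht.2]⟩) fun t ht => ?_
      simp only
      split_ifs with h
      · have : t = 1 / 2 := le_antisymm h ht.1
        norm_num [this, heq]
      · rfl
  · have main : ∀ s ∈ Icc (0 : ℝ) 1, ∀ t ∈ Icc (0 : ℝ) 1, s ≤ 1 / 2 → 1 / 2 < t →
        η (2 * s) ≠ γ (2 * t - 1) := by
      intro s hs t ht h1 h2 he
      rcases h1.eq_or_lt with h | h
      · have : (2 : ℝ) * s = 1 := by linarith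
        rw [this, heq] at he
        have := hγ.injOn (by simp) ⟨by linarith, by linarith [ht.2]⟩ he
        linarith
      · exact hdis (2 * s) ⟨by linarith [hs.1], by linarith⟩
          ⟨2 * t - 1, ⟨by linarith, by linarith [ht.2]⟩, he.symm⟩
    intro s hs t ht he
    simp only at he
    split_ifs at he with h1 h2 h2
    · have := hη.injOn ⟨by linarith [hs.1], by linarith⟩ ⟨by linarith [ht.1], by linarith⟩ he
      linarith
    · exact (main s hs t ht h1 (not_le.1 h2) he).elim
    · exact (main t ht s hs h2 (not_le.1 h1) he.symm).elim
    · rw [not_le] at h1 h2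
      have := hγ.injOn ⟨by linarith, by linarith [hs.2]⟩ ⟨by linarith, by linarith [ht.2]⟩ he
      linarith
  · intro u hu
    split_ifs with h
    · exact hη.mem _ ⟨by linarith [hu.1], by linarith⟩
    · rw [not_le] at h
      exact hγ.mem _ ⟨by linarith, by linarith [hu.2]⟩

/-- There is a small flow box around each regular point of the frontier of an invariant set. -/
theorem exists_flowBox [ChartedSpace (EuclideanHalfSpace 2) X] (hφ : IsFlow φ) {z : X}
    (hz : ∃ t, φ t z ≠ z) {W : Set X} (hW : ∀ t, ∀ x ∈ W, φ t x ∈ W) (hzW : z ∈ closure W)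
    (hzW' : z ∉ W) {r₀ : ℝ} (hr₀ : 0 < r₀) :
    ∃ h N π τ, z ∈ N ∧ FlowBox φ r₀ h N π τ := by
  have : LocallyPathConnectedSpace X :=
    ChartedSpace.locallyPathConnectedSpace (EuclideanHalfSpace 2) X
  obtain ⟨r, hr, hrr₀, Y, O, σ, hsec⟩ := hφ.exists_localSection hz hr₀
  suffices hsuff : ∃ γ, SectionArc O Y γ ∧
      (fun q : ℝ × ℝ => φ q.2 (γ q.1)) '' (Icc 0 1 ×ˢ Icc (-r) r) ∈ 𝓝 z by
    obtain ⟨γ, hγ, hγz⟩ := hsuff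
    obtain ⟨N, π, τ, hzN, hN⟩ := hγ.exists_flowBox hφ hsec hγz
    exact ⟨γ, N, π, τ, hzN, { hN with abs_le := fun x hx => (hN.abs_le x hx).trans hrr₀ }⟩
  by_contra! hno
  obtain ⟨γ, hγ, hγ0⟩ : ∃ γ, SectionArc O Y γ ∧ γ 0 = z := by
    obtain ⟨w, hwW, -, f, hfc, hf0, hf1, hfm⟩ :=
      (mem_closure_iff_frequently.1 hzW).and_eventually
        (hsec.eventually_path hφ univ_mem) |>.exists
    obtain ⟨γ, hγc, hγi, hγ0, -, hγf⟩ := exists_arc_of_path (f := fun t => f (1 - t))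
      (by fun_prop) (by
        simp only [sub_zero, sub_self, hf0, hf1]
        rintro h
        exact hzW' (h ▸ hW _ _ hwW))
    refine ⟨γ, ⟨hγc, hγi, fun u hu => ?_⟩, by simpa [hf1] using hγ0⟩
    obtain ⟨t, -, ht⟩ := hγf ⟨u, hu, rfl⟩
    rw [← ht]
    exact (hfm _).1
  refine hno γ hγ ?_
  have hγ1 : γ 1 ≠ z := fun h => one_ne_zero (hγ.injOn (by simp) (by simp) (h.trans hγ0.symm))
  have hAc : IsClosed (γ '' Icc 0 1) :=
    (isCompact_Icc.image_of_continuousOn hγ.continuousOn).isClosed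
  filter_upwards [hsec.eventually_path hφ (isOpen_ne.mem_nhds hγ1.symm)]
    with x ⟨hxO, f, hfc, hf0, hf1, hfm⟩
  suffices hxA : φ (σ x) x ∈ γ '' Icc 0 1 by
    obtain ⟨u, hu, hux⟩ := hxA
    have hσ := abs_lt.1 (hsec.abs_lt x hxO)
    refine ⟨(u, -σ x), ⟨hu, by linarith, by linarith⟩, ?_⟩
    simp only
    rw [hux, hφ.map_map, neg_add_cancel, hφ.map_zero]
  by_contra hxA
  have hzA : z ∈ γ '' Icc 0 1 := ⟨0, by simp, hγ0⟩
  obtain ⟨η, hηc, hηi, hη0, hη1, hηf⟩ := exists_arc_of_path hfc (by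
    rw [hf0, hf1]
    rintro h
    exact hxA (h ▸ hzA))
  have hηm : ∀ u ∈ Icc (0 : ℝ) 1, η u ∈ O ∩ Y ∩ {x | x ≠ γ 1} := by
    intro u hu
    obtain ⟨t, -, ht⟩ := hηf ⟨u, hu, rfl⟩
    rw [← ht]
    exact hfm t
  have hη : SectionArc O Y η := ⟨hηc, hηi, fun u hu => (hηm u hu).1⟩
  have hcpt : IsCompact (Icc (0 : ℝ) 1 ∩ η ⁻¹' (γ '' Icc 0 1)) :=
    isCompact_Icc.of_isClosed_subset
      (hηc.preimage_isClosed_of_isClosed isClosed_Icc hAc) inter_subset_left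
  have hfirst := hcpt.sInf_mem ⟨1, by simp, by rwa [mem_preimage, hη1, hf1]⟩
  set u₁ := sInf (Icc (0 : ℝ) 1 ∩ η ⁻¹' (γ '' Icc 0 1)) with hu₁
  have hlt : ∀ u ∈ Ico 0 u₁, η u ∉ γ '' Icc 0 1 := fun u hu hmem =>
    absurd (csInf_le hcpt.bddBelow ⟨⟨hu.1, hu.2.le.trans hfirst.1.2⟩, hmem⟩) (not_le.2 hu.2)
  have hu₁pos : 0 < u₁ := by
    refine hfirst.1.1.lt_of_ne fun h => hxA ?_
    have := hfirst.2
    rwa [← h, mem_preimage, hη0, hf0] at this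
  obtain ⟨w, hw, hwu⟩ := hfirst.2
  have hw1 : w < 1 := hw.2.lt_of_ne fun h => (hηm u₁ hfirst.1).2 (by rw [← hwu, h])
  rcases hw.1.eq_or_lt with hw0 | hw0
  · have hu₁1 : u₁ = 1 := hηi hfirst.1 (by simp) (by rw [← hwu, ← hw0, hγ0, hη1, hf1])
    rw [hu₁1] at hlt
    have happ := hη.append hγ (by rw [hη1, hf1, hγ0]) hlt
    refine hno _ happ ?_
    have := happ.image_mem_nhds hφ hsec (u := 1 / 2) (by norm_num)
    simpa [hη1, hf1] using this
  · have hnh := hγ.image_mem_nhds hφ hsec ⟨hw0, hw1⟩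
    rw [hwu] at hnh
    have hIio : Icc (0 : ℝ) 1 ∈ 𝓝[<] u₁ := by
      filter_upwards [Ioo_mem_nhdsLT hu₁pos] with u hu
      exact ⟨hu.1.le, hu.2.le.trans hfirst.1.2⟩
    have htend : Tendsto η (𝓝[<] u₁) (𝓝 (η u₁)) :=
      (hηc u₁ hfirst.1).mono_left (nhdsWithin_le_of_mem hIio)
    obtain ⟨u, ⟨⟨v, s⟩, ⟨hv, hs⟩, hvs⟩, hu⟩ :=
      ((htend.eventually hnh).and (Ioo_mem_nhdsLT hu₁pos)).exists
    simp only at hv hs hvs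
    have hs0 : s = 0 := hsec.eq_zero_of_mem hφ (hγ.mem v hv)
      (_root_.abs_le.2 ⟨by linarith [hs.1], by linarith [hs.2]⟩)
      (hvs ▸ (hηm u ⟨hu.1.le, hu.2.le.trans hfirst.1.2⟩).1.2)
    rw [hs0, hφ.map_zero] at hvs
    exact hlt u ⟨hu.1.le, hu.2⟩ ⟨v, hv, hvs⟩

end IsFlow

namespace IsFlow

variable {X : Type*} [MetricSpace X] {φ : ℝ → X → X} {p : X}

/-- The unstable set of `p`: the points whose backward orbit converges to `p`. -/
def unstableSet (φ : ℝ → X → X) (p : X) : Set X :=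
  {x | Tendsto (fun t => φ (-t) x) atTop (𝓝 p)}

theorem mem_unstableSet_of_mem (hφ : IsFlow φ) (s : ℝ) {x : X} (hx : x ∈ unstableSet φ p) :
    φ s x ∈ unstableSet φ p := by
  refine (Tendsto.comp hx (tendsto_atTop_add_const_right atTop (-s) tendsto_id)).congr fun t => ?_
  simp only [Function.comp_apply, id, hφ.map_map]
  congr 1
  ring

theorem mem_unstableSet_iff (hφ : IsFlow φ) (s : ℝ) {x : X} :
    φ s x ∈ unstableSet φ p ↔ x ∈ unstableSet φ p := by
  refine ⟨fun h => ?_, hφ.mem_unstableSet_of_mem s⟩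
  have := hφ.mem_unstableSet_of_mem (-s) h
  rwa [hφ.map_map, neg_add_cancel, hφ.map_zero] at this

theorem self_mem_unstableSet (hp : ∀ t, φ t p = p) : p ∈ unstableSet φ p :=
  tendsto_const_nhds.congr fun t => (hp (-t)).symm

theorem exists_isolating (hpe : PosKinematicExpansive φ) (hp : ∀ t, φ t p = p) :
    ∃ δ > 0, ∀ x, (∀ t, 0 ≤ t → dist (φ t x) p ≤ δ) → x = p := by
  obtain ⟨δ, hδ, h⟩ := hpe 1 one_pos
  refine ⟨δ / 2, half_pos hδ, fun x hx => ?_⟩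
  obtain ⟨s, -, hs⟩ := h p x fun t ht => by
    rw [hp, dist_comm]
    exact (hx t ht).trans_lt (half_lt_self hδ)
  rw [hs, hp]

theorem backward_stable [CompactSpace X] (hφ : IsFlow φ) (hp : ∀ t, φ t p = p) {δ : ℝ}
    (hδ : ∀ x, (∀ t, 0 ≤ t → dist (φ t x) p ≤ δ) → x = p) {δ₁ : ℝ} (hδ₁ : 0 < δ₁)
    (hle : δ₁ ≤ δ) : ∀ᶠ x in 𝓝 p, ∀ t, 0 ≤ t → dist (φ (-t) x) p ≤ δ₁ := by
  have hc : ∀ t, Continuous fun x => dist (φ t x) p := fun t =>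
    (hφ.continuous continuous_const continuous_id).dist continuous_const
  obtain ⟨T, hT⟩ : ∃ T : ℕ, ∀ y ∈ sphere p δ₁, ∃ t : ℝ, 0 ≤ t ∧ t ≤ T ∧ δ < dist (φ t y) p := by
    obtain ⟨T, hT⟩ := (isCompact_sphere p δ₁).elim_directed_cover
      (fun n : ℕ => {y | ∃ t : ℝ, 0 ≤ t ∧ t ≤ n ∧ δ < dist (φ t y) p})
      (fun n => by
        have : {y | ∃ t : ℝ, 0 ≤ t ∧ t ≤ n ∧ δ < dist (φ t y) p} =
            ⋃ t ∈ Icc (0 : ℝ) n, {y | δ < dist (φ t y) p} := by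
          ext y
          simp [and_assoc]
        rw [this]
        exact isOpen_biUnion fun t _ => isOpen_lt continuous_const (hc t))
      (by
        intro y hy
        have hyp : y ≠ p := by
          rintro rfl
          rw [mem_sphere, dist_self] at hy
          exact hδ₁.ne hy
        by_contra hno
        refine hyp (hδ y fun t ht => ?_)
        by_contra! hlt
        obtain ⟨n, hn⟩ := exists_nat_ge t
        exact hno (mem_iUnion.2 ⟨n, t, ht, hn, hlt⟩))
      (directed_of_isDirected_le fun m n hmn y ⟨t, h0, h1, h2⟩ =>
        ⟨t, h0, h1.trans (by exact_mod_cast hmn), h2⟩)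
    exact ⟨T, fun y hy => hT hy⟩
  have hnear : ∀ᶠ x in 𝓝 p, ∀ t ∈ Icc (0 : ℝ) T, dist (φ t x) p < δ₁ := by
    refine isCompact_Icc.eventually_forall_of_forall_eventually fun t _ => ?_
    have : Continuous fun q : X × ℝ => dist (φ q.2 q.1) p :=
      (hφ.continuous continuous_snd continuous_fst).dist continuous_const
    refine this.continuousAt.eventually (gt_mem_nhds ?_)
    simpa [hp] using hδ₁
  filter_upwards [hnear] with x hx t ht
  by_contra! hlt
  set g : ℝ → ℝ := fun s => dist (φ (-s) x) p with hg
  have hgc : Continuous g := (hφ.continuous continuous_neg continuous_const).dist continuous_const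
  have hcpt : IsCompact (Icc 0 t ∩ {s | δ₁ ≤ g s}) :=
    isCompact_Icc.inter_right (isClosed_le continuous_const hgc)
  have hmem := hcpt.sInf_mem ⟨t, ⟨ht, le_rfl⟩, hlt.le⟩
  set s₀ := sInf (Icc 0 t ∩ {s | δ₁ ≤ g s}) with hs₀
  have hlt' : ∀ s, 0 ≤ s → s < s₀ → g s < δ₁ := by
    intro s h0 h1
    by_contra! h
    exact absurd (csInf_le hcpt.bddBelow ⟨⟨h0, h1.le.trans hmem.1.2⟩, h⟩) (not_le.2 h1)
  have h0 : g 0 < δ₁ := by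
    have := hx 0 ⟨le_rfl, Nat.cast_nonneg T⟩
    simpa [hg] using this
  have hs₀pos : 0 < s₀ := hmem.1.1.lt_of_ne fun h => by
    have := hmem.2
    rw [← h] at this
    exact absurd h0 (not_lt.2 this)
  have hs₀eq : g s₀ = δ₁ := by
    refine le_antisymm ?_ hmem.2
    refine le_of_tendsto (hgc.continuousAt.continuousWithinAt (s := Iio s₀)) ?_
    filter_upwards [Ioo_mem_nhdsLT hs₀pos] with s hs
    exact (hlt' s hs.1.le hs.2).le
  obtain ⟨u, hu0, huT, hu⟩ := hT (φ (-s₀) x) hs₀eq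
  rw [hφ.map_map] at hu
  rcases le_total u s₀ with h | h
  · have h1 : g (s₀ - u) ≤ δ₁ := by
      rcases hu0.eq_or_lt with h2 | h2
      · rw [← h2, sub_zero, hs₀eq]
      · exact (hlt' _ (by linarith) (by linarith)).le
    simp only [hg, neg_sub] at h1
    rw [← sub_eq_add_neg] at hu
    linarith
  · have h1 := hx (u - s₀) ⟨by linarith, by linarith⟩
    rw [← sub_eq_add_neg] at hu
    linarith

theorem unstableSet_mem_nhds [CompactSpace X] (hφ : IsFlow φ) (hpe : PosKinematicExpansive φ)
    (hp : ∀ t, φ t p = p) : unstableSet φ p ∈ 𝓝 p := by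
  obtain ⟨δ, hδ, hiso⟩ := exists_isolating hpe hp
  filter_upwards [hφ.backward_stable hp hiso hδ le_rfl] with x hx
  refine tendsto_nhds_of_unique_mapClusterPt fun y hy => hiso y fun s hs => ?_
  have hcl : IsClosed {y | dist (φ s y) p ≤ δ} := isClosed_le
    ((hφ.continuous continuous_const continuous_id).dist continuous_const) continuous_const
  by_contra hys
  obtain ⟨t, ht, hts⟩ := ((hy.frequently (hcl.isOpen_compl.mem_nhds hys)).and_eventually
    (eventually_ge_atTop s)).exists
  refine ht ?_
  have := hx (t - s) (by linarith)
  rw [mem_ofPred_eq, hφ.map_map]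
  rwa [neg_sub, sub_eq_add_neg] at this

theorem isOpen_unstableSet [CompactSpace X] (hφ : IsFlow φ) (hpe : PosKinematicExpansive φ)
    (hp : ∀ t, φ t p = p) : IsOpen (unstableSet φ p) := by
  rw [isOpen_iff_mem_nhds]
  intro x hx
  obtain ⟨t, ht⟩ := (Tendsto.eventually hx
    (eventually_eventually_nhds.2 (hφ.unstableSet_mem_nhds hpe hp))).exists
  have hc : Continuous (φ (-t)) := hφ.continuous continuous_const continuous_id
  filter_upwards [hc.continuousAt.eventually ht] with y hy
  exact (hφ.mem_unstableSet_iff (-t)).1 hy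

theorem unstableSet_ne_univ [CompactSpace X] [Nontrivial X] (hφ : IsFlow φ)
    (hpe : PosKinematicExpansive φ) (hp : ∀ t, φ t p = p) : unstableSet φ p ≠ univ := by
  obtain ⟨x, hx⟩ := exists_ne p
  obtain ⟨δ, hδ, hiso⟩ := exists_isolating hpe hp
  have hd : 0 < dist x p := dist_pos.2 hx
  have hst := hφ.backward_stable hp hiso (lt_min hδ (half_pos hd)) (min_le_left _ _)
  obtain ⟨y, hy⟩ := exists_clusterPt_of_compactSpace (map (fun t => φ t x) atTop)
  intro huniv
  have hyW : y ∈ unstableSet φ p := huniv ▸ mem_univ y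
  obtain ⟨T, hT⟩ := (Tendsto.eventually hyW (eventually_eventually_nhds.2 hst)).exists
  have hc : Continuous (φ (-T)) := hφ.continuous continuous_const continuous_id
  obtain ⟨t, ht, htT⟩ := ((MapClusterPt.frequently hy
    (hc.continuousAt.eventually hT)).and_eventually (eventually_ge_atTop T)).exists
  have h1 := ht (t - T) (by linarith)
  rw [hφ.map_map, hφ.map_map, show -(t - T) + -T + t = 0 by ring, hφ.map_zero] at h1
  linarith [min_le_right δ (dist x p / 2)]

theorem exists_mem_closure_diff_unstableSet [CompactSpace X] [ConnectedSpace X] [Nontrivial X]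
    (hφ : IsFlow φ) (hpe : PosKinematicExpansive φ) (hp : ∀ t, φ t p = p) :
    (closure (unstableSet φ p) \ unstableSet φ p).Nonempty := by
  by_contra hno
  have hcl : IsClosed (unstableSet φ p) :=
    isClosed_of_closure_subset (sdiff_eq_empty.1 (not_nonempty_iff_eq_empty.1 hno))
  rcases isClopen_iff.1 ⟨hcl, hφ.isOpen_unstableSet hpe hp⟩ with h | h
  · have := self_mem_unstableSet hp
    rw [h] at this
    exact this
  · exact hφ.unstableSet_ne_univ hpe hp h

theorem exists_ne_of_mem_closure_diff [CompactSpace X] (hφ : IsFlow φ)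
    (hpe : PosKinematicExpansive φ) (hp : ∀ t, φ t p = p) {q : X}
    (hq : q ∈ closure (unstableSet φ p) \ unstableSet φ p) : ∃ t, φ t q ≠ q := by
  by_contra! hfix
  obtain ⟨x, hx1, hx2⟩ := (mem_closure_iff_nhds.1 hq.1) _ (hφ.unstableSet_mem_nhds hpe hfix)
  have hpq : p = q := tendsto_nhds_unique hx2 hx1
  exact hq.2 (hpq ▸ self_mem_unstableSet hp)

theorem map_mem_closure_diff (hφ : IsFlow φ) (t : ℝ) {x : X}
    (hx : x ∈ closure (unstableSet φ p) \ unstableSet φ p) :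
    φ t x ∈ closure (unstableSet φ p) \ unstableSet φ p := by
  refine ⟨map_mem_closure (hφ.continuous continuous_const continuous_id) hx.1
    fun y hy => hφ.mem_unstableSet_of_mem t hy, fun h => hx.2 ((hφ.mem_unstableSet_iff t).1 h)⟩

end IsFlow

theorem nontrivial_of_chartedSpace_euclideanHalfSpace (S : Type*) [TopologicalSpace S] [Nonempty S]
    [ChartedSpace (EuclideanHalfSpace 2) S] : Nontrivial S := by
  by_contra hS
  rw [not_nontrivial_iff_subsingleton] at hS
  obtain ⟨p⟩ := ‹Nonempty S›
  set e := chartAt (EuclideanHalfSpace 2) p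
  have htgt : e.target = {e p} := by
    refine eq_singleton_iff_unique_mem.2 ⟨e.map_source (mem_chart_source _ p), fun y hy => ?_⟩
    rw [← e.right_inv hy, Subsingleton.elim (e.symm y) p]
  set c : ℝ → EuclideanHalfSpace 2 := fun t => ⟨!₂[(e p).1 0, (e p).1 1 + t], (e p).2⟩
  have hc : Continuous c := Continuous.subtype_mk (by fun_prop) _
  have hpre : c ⁻¹' e.target = {0} := by
    ext t
    rw [htgt, mem_preimage, mem_singleton_iff, mem_singleton_iff]
    constructor
    · intro h
      have := congrArg (fun y : EuclideanHalfSpace 2 => y.1 1) h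
      simpa [c] using this
    · rintro rfl
      apply Subtype.ext
      ext i
      fin_cases i <;> simp [c]
  exact not_isOpen_singleton (0 : ℝ) (hpre ▸ e.open_target.preimage hc)

namespace IsFlow

variable {X : Type*} [MetricSpace X] {φ : ℝ → X → X} {p : X}

theorem false_of_recurrent_backward {x : X} (hx : x ∈ unstableSet φ p) {K : Set X}
    (hK : IsClosed K) (hp : p ∉ K) {Θ : ℕ → ℝ} (hΘ : Tendsto Θ atTop atTop)
    (h : ∀ k, φ (-Θ k) x ∈ K) : False :=
  hp (hK.mem_of_tendsto (Tendsto.comp hx hΘ) (Eventually.of_forall h))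

theorem eq_of_mem_unstableSet_of_periodic (hφ : IsFlow φ) {x : X} (hx : x ∈ unstableSet φ p)
    {T : ℝ} (hT : 0 < T) (h : φ T x = x) : x = p := by
  by_contra hne
  have hper : ∀ k : ℕ, φ (-(k * T)) x = x := by
    intro k
    induction k with
    | zero => simp [hφ.map_zero]
    | succ k ih =>
      have h' : φ (-T) x = x := by
        conv_lhs => rw [← h]
        rw [hφ.map_map, neg_add_cancel, hφ.map_zero]
      calc φ (-((k + 1 : ℕ) * T)) x = φ (-(k * T)) (φ (-T) x) := by
            rw [hφ.map_map]
            congr 1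
            push_cast
            ring
        _ = x := by rw [h', ih]
  exact false_of_recurrent_backward hx (K := {x}) isClosed_singleton (fun h => hne h.symm)
    (tendsto_natCast_atTop_atTop.atTop_mul_const hT) hper

/-- Near the initial point, the curve `γ` flows backwards into the curve `γ'`. -/
def Link (φ : ℝ → X → X) (γ γ' : ℝ → X) : Prop :=
  ∃ a f θ, 0 < a ∧ a ≤ 1 ∧ ContinuousOn f (Icc 0 a) ∧ ContinuousOn θ (Icc 0 a) ∧ f 0 = (0 : ℝ) ∧
    (∀ t ∈ Ioc 0 a, 0 < f t ∧ f t ≤ 1) ∧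
    ∀ t ∈ Icc 0 a, (1 / 2 : ℝ) ≤ θ t ∧ γ' (f t) = φ (-θ t) (γ t)

theorem exists_small_of_continuousOn {a b : ℝ} (ha : 0 < a) (hb : 0 < b) {f : ℝ → ℝ}
    (hf : ContinuousOn f (Icc 0 a)) (hf0 : f 0 = 0) :
    ∃ a', 0 < a' ∧ a' ≤ a ∧ ∀ t ∈ Icc 0 a', f t ≤ b := by
  have h0 : Tendsto f (𝓝[Icc 0 a] 0) (𝓝 0) := by
    have := hf 0 ⟨le_rfl, ha.le⟩
    rwa [ContinuousWithinAt, hf0] at this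
  obtain ⟨ε, hε, h⟩ := Metric.mem_nhdsWithin_iff.1 (h0.eventually (gt_mem_nhds hb))
  refine ⟨min a (ε / 2), lt_min ha (half_pos hε), min_le_left _ _, fun t ht => le_of_lt ?_⟩
  refine h (a := t) ⟨?_, ht.1, ht.2.trans (min_le_left _ _)⟩
  rw [mem_ball, Real.dist_eq, sub_zero, abs_of_nonneg ht.1]
  exact (ht.2.trans (min_le_right _ _)).trans_lt (half_lt_self hε)

theorem Link.trans (hφ : IsFlow φ) {γ γ' γ'' : ℝ → X} (h : Link φ γ γ') (h' : Link φ γ' γ'') :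
    Link φ γ γ'' := by
  obtain ⟨a, f, θ, ha, ha1, hfc, hθc, hf0, hf, hθ⟩ := h
  obtain ⟨a', f', θ', ha', ha1', hfc', hθc', hf0', hf', hθ'⟩ := h'
  obtain ⟨b, hb, hba, hfb⟩ := exists_small_of_continuousOn ha ha' hfc hf0
  have hsub : Icc 0 b ⊆ Icc 0 a := Icc_subset_Icc_right hba
  have hmem : ∀ t ∈ Icc 0 b, f t ∈ Icc 0 a' := by
    intro t ht
    refine ⟨?_, hfb t ht⟩
    rcases ht.1.eq_or_lt with h | h
    · rw [← h, hf0]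
    · exact (hf t ⟨h, ht.2.trans hba⟩).1.le
  refine ⟨b, f' ∘ f, fun t => θ t + θ' (f t), hb, hba.trans ha1,
    hfc'.comp (hfc.mono hsub) hmem, (hθc.mono hsub).add (hθc'.comp (hfc.mono hsub) hmem),
    by simp [hf0, hf0'], fun t ht => hf' _ ⟨(hf t ⟨ht.1, ht.2.trans hba⟩).1,
      (hmem t ⟨ht.1.le, ht.2⟩).2⟩, fun t ht => ⟨?_, ?_⟩⟩
  · linarith [(hθ t (hsub ht)).1, (hθ' _ (hmem t ht)).1]
  · rw [Function.comp_apply, (hθ' _ (hmem t ht)).2, (hθ t (hsub ht)).2, hφ.map_map]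
    congr 1
    ring

/-- A sequence of points which follow each other along the flow and converge to a regular
point of a periodic orbit contradicts positive expansiveness. -/
theorem false_of_forward_spiral (hφ : IsFlow φ) (hpe : PosKinematicExpansive φ) {x : ℕ → X}
    (hx : ∀ k, x k ∈ unstableSet φ p) (hxp : ∀ k, x k ≠ p) {θ : ℕ → ℝ} {T : ℝ} {b : X}
    (hstep : ∀ k, x (k + 1) = φ (θ k) (x k)) (hθ : ∀ k, 1 / 2 ≤ θ k)
    (hθT : Tendsto θ atTop (𝓝 T)) (hxb : Tendsto x atTop (𝓝 b)) : False := by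
  have hT : 1 / 2 ≤ T := ge_of_tendsto hθT (Eventually.of_forall hθ)
  have hb : φ T b = b := by
    refine tendsto_nhds_unique (f := fun k => x (k + 1)) (l := atTop) ?_
      (hxb.comp (tendsto_add_atTop_nat 1))
    simp only [hstep]
    exact (hφ.1.tendsto (T, b)).comp (hθT.prodMk_nhds hxb)
  obtain ⟨δ, hδ, hexp⟩ := hpe (T / 2) (by linarith)
  have htube : ∀ᶠ y in 𝓝 b, ∀ s ∈ Icc 0 (2 * T), dist (φ s y) (φ (s + T) y) < δ := by
    refine isCompact_Icc.eventually_forall_of_forall_eventually fun s _ => ?_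
    have : Continuous fun q : X × ℝ => dist (φ q.2 q.1) (φ (q.2 + T) q.1) :=
      (hφ.continuous continuous_snd continuous_fst).dist
        (hφ.continuous (by fun_prop) continuous_fst)
    refine this.continuousAt.eventually (gt_mem_nhds ?_)
    simpa only [← hφ.map_map, hb, dist_self] using hδ
  obtain ⟨K, hK⟩ := eventually_atTop.1 ((hxb.eventually htube).and
    (hθT.eventually (gt_mem_nhds (by linarith : T < 2 * T))))
  have main : ∀ N : ℕ, ∀ k ≥ K, ∀ t : ℝ, 0 ≤ t → t ≤ N / 2 →
      dist (φ t (x k)) (φ (t + T) (x k)) < δ := by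
    intro N
    induction N with
    | zero =>
      intro k hk t ht htN
      simp only [Nat.cast_zero, zero_div] at htN
      exact (hK k hk).1 t ⟨ht, by linarith⟩
    | succ N ih =>
      intro k hk t ht htN
      push_cast at htN
      rcases le_total t (θ k) with h | h
      · exact (hK k hk).1 t ⟨ht, h.trans (hK k hk).2.le⟩
      · have h1 := ih (k + 1) (hk.trans k.le_succ) (t - θ k) (by linarith)
          (by linarith [hθ k])
        rw [hstep, hφ.map_map, hφ.map_map] at h1
        rwa [sub_add_cancel, show t - θ k + T + θ k = t + T by ring] at h1
  obtain ⟨s, hs, hsx⟩ := hexp (x K) (φ T (x K)) fun t ht => by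
    obtain ⟨N, hN⟩ := exists_nat_ge (2 * t)
    rw [hφ.map_map]
    exact main N K le_rfl t ht (by linarith)
  refine hxp K (hφ.eq_of_mem_unstableSet_of_periodic (hx K) (T := T - s)
    (by linarith [(abs_lt.1 hs).2]) ?_)
  have := congrArg (φ (-s)) hsx
  rw [hφ.map_map, hφ.map_map, neg_add_cancel, hφ.map_zero] at this
  rwa [sub_eq_neg_add]

theorem false_of_first_return (hφ : IsFlow φ) (hpe : PosKinematicExpansive φ) {γ : ℝ → X}
    (hγ : ContinuousOn γ (Icc 0 1)) (hγW : ∀ t ∈ Ioc (0 : ℝ) 1, γ t ∈ unstableSet φ p)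
    (hγp : p ∉ γ '' Icc 0 1) (h : Link φ γ γ) : False := by
  obtain ⟨a, f, θ, ha, ha1, hfc, hθc, hf0, hf, hθ⟩ := h
  have hW : ∀ t ∈ Ioc 0 a, γ t ∈ unstableSet φ p := fun t ht => hγW t ⟨ht.1, ht.2.trans ha1⟩
  have hne : ∀ t ∈ Ioc 0 a, γ t ≠ p := fun t ht he =>
    hγp ⟨t, ⟨ht.1.le, ht.2.trans ha1⟩, he⟩
  have hfix : ∀ t ∈ Ioc 0 a, f t ≠ t := by
    intro t ht he
    obtain ⟨h1, h2⟩ := hθ t ⟨ht.1.le, ht.2⟩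
    rw [he] at h2
    refine hne t ht (hφ.eq_of_mem_unstableSet_of_periodic (hW t ht) (T := θ t) (by linarith) ?_)
    conv_lhs => rw [h2]
    rw [hφ.map_map, add_neg_cancel, hφ.map_zero]
  have hIoc : Ioc 0 a ⊆ Icc 0 a := Ioc_subset_Icc_self
  have hac : a ∈ Ioc 0 a := ⟨ha, le_rfl⟩
  have hsign : (∀ t ∈ Ioc 0 a, f t < t) ∨ ∀ t ∈ Ioc 0 a, t < f t := by
    by_contra! hno
    obtain ⟨⟨s, hs, hs'⟩, t, ht, ht'⟩ := hno
    obtain ⟨u, hu, hu0⟩ := (isPreconnected_Ioc (a := (0 : ℝ)) (b := a)).intermediate_value ht hs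
      ((hfc.mono hIoc).sub continuousOn_id)
      (show (0 : ℝ) ∈ Icc (f t - t) (f s - s) from ⟨sub_nonpos.2 ht', sub_nonneg.2 hs'⟩)
    exact hfix u hu (sub_eq_zero.1 hu0)
  rcases hsign with hlt | hgt
  · set t : ℕ → ℝ := fun k => f^[k] a with ht
    have htm : ∀ k, t k ∈ Ioc 0 a := by
      intro k
      induction k with
      | zero => exact hac
      | succ k ih =>
        simp only [ht, Function.iterate_succ_apply']
        exact ⟨(hf _ ih).1, (hlt _ ih).le.trans ih.2⟩
    set Θ : ℕ → ℝ := fun k => ∑ i ∈ Finset.range k, θ (t i) with hΘ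
    have hΘγ : ∀ k, φ (-Θ k) (γ a) = γ (t k) := by
      intro k
      induction k with
      | zero => simp [hΘ, ht, hφ.map_zero]
      | succ k ih =>
        have h1 : t (k + 1) = f (t k) := by simp only [ht, Function.iterate_succ_apply']
        rw [h1, (hθ _ (hIoc (htm k))).2, ← ih, hφ.map_map]
        congr 1
        simp only [hΘ, Finset.sum_range_succ]
        ring
    have hΘk : ∀ k : ℕ, k * (1 / 2 : ℝ) ≤ Θ k := by
      intro k
      have := Finset.card_nsmul_le_sum (Finset.range k) (fun i => θ (t i)) (1 / 2)
        fun i _ => (hθ _ (hIoc (htm i))).1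
      simpa using this
    refine false_of_recurrent_backward (hW a hac)
      (isCompact_Icc.image_of_continuousOn hγ).isClosed hγp
      (tendsto_atTop_mono hΘk (tendsto_natCast_atTop_atTop.atTop_mul_const (by norm_num)))
      fun k => ?_
    rw [hΘγ]
    exact ⟨t k, ⟨(htm k).1.le, (htm k).2.trans ha1⟩, rfl⟩
  · have hpre : ∀ s ∈ Ioc 0 a, ∃ s', s' ∈ Ioc 0 a ∧ s' < s ∧ f s' = s := by
      intro s hs
      obtain ⟨s', hs', he⟩ := intermediate_value_Ioo hs.1.le
        (hfc.mono (Icc_subset_Icc_right hs.2)) (show s ∈ Ioo (f 0) (f s) from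
          ⟨by rw [hf0]; exact hs.1, hgt s hs⟩)
      exact ⟨s', ⟨hs'.1, hs'.2.le.trans hs.2⟩, hs'.2, he⟩
    choose! g hg hgl hgf using hpre
    set t : ℕ → ℝ := fun k => g^[k] a with ht
    have hsucc : ∀ k, t (k + 1) = g (t k) := fun k => by
      simp only [ht, Function.iterate_succ_apply']
    have htm : ∀ k, t k ∈ Ioc 0 a := by
      intro k
      induction k with
      | zero => exact hac
      | succ k ih =>
        rw [hsucc]
        exact hg _ ih
    have hanti : Antitone t := antitone_nat_of_succ_le fun k => by
      rw [hsucc]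
      exact (hgl _ (htm k)).le
    have hbdd : BddBelow (range t) := ⟨0, by rintro _ ⟨k, rfl⟩; exact (htm k).1.le⟩
    have hlim := tendsto_atTop_ciInf hanti hbdd
    set l := ⨅ k, t k with hl
    have hlm : l ∈ Icc 0 a := isClosed_Icc.mem_of_tendsto hlim
      (Eventually.of_forall fun k => hIoc (htm k))
    have hlimw : Tendsto (fun k => t (k + 1)) atTop (𝓝[Icc 0 a] l) :=
      tendsto_nhdsWithin_iff.2 ⟨hlim.comp (tendsto_add_atTop_nat 1),
        Eventually.of_forall fun k => hIoc (htm _)⟩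
    have hfl : f l = l := by
      refine tendsto_nhds_unique ((hfc l hlm).tendsto.comp hlimw) (hlim.congr fun k => ?_)
      rw [Function.comp_apply, hsucc, hgf _ (htm k)]
    have hl0 : l = 0 := by
      rcases hlm.1.eq_or_lt with h | h
      · exact h.symm
      · exact (hfix l ⟨h, hlm.2⟩ hfl).elim
    refine hφ.false_of_forward_spiral hpe (p := p) (x := fun k => γ (t k))
      (θ := fun k => θ (t (k + 1))) (T := θ l) (b := γ l) (fun k => hW _ (htm k))
      (fun k => hne _ (htm k)) (fun k => ?_) (fun k => (hθ _ (hIoc (htm _))).1)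
      ((hθc l hlm).tendsto.comp hlimw) ?_
    · have h2 := (hθ _ (hIoc (htm (k + 1)))).2
      rw [hsucc, hgf _ (htm k)] at h2
      rw [hsucc, h2, hφ.map_map, add_neg_cancel, hφ.map_zero]
    · have hsub : Icc 0 a ⊆ Icc 0 1 := Icc_subset_Icc_right ha1
      exact (((hγ.mono hsub) l hlm).tendsto.comp (tendsto_nhdsWithin_iff.2
        ⟨hlim, Eventually.of_forall fun k => hIoc (htm _)⟩))

theorem Link.of_rescale {X : Type*} {φ : ℝ → X → X} {γ : ℝ → X} {κ : ℝ} (hκ : 0 < κ)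
    (h : Link φ γ fun t => γ (κ * t)) : Link φ γ γ := by
  obtain ⟨a, f, θ, ha, ha1, hfc, hθc, hf0, hf, hθ⟩ := h
  obtain ⟨b, hb, hba, hfb⟩ := exists_small_of_continuousOn ha (inv_pos.2 hκ) hfc hf0
  have hsub : Icc 0 b ⊆ Icc 0 a := Icc_subset_Icc_right hba
  refine ⟨b, fun t => κ * f t, θ, hb, hba.trans ha1, continuousOn_const.mul (hfc.mono hsub),
    hθc.mono hsub, by simp [hf0], fun t ht => ⟨mul_pos hκ (hf t ⟨ht.1, ht.2.trans hba⟩).1, ?_⟩,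
    fun t ht => hθ t (hsub ht)⟩
  calc κ * f t ≤ κ * κ⁻¹ := by gcongr; exact hfb t ⟨ht.1.le, ht.2⟩
    _ = 1 := mul_inv_cancel₀ hκ.ne'

end IsFlow

namespace IsFlow

variable {X : Type*} [MetricSpace X] {φ : ℝ → X → X} {p : X}

/-- The section `h` maps the half-open segment from `u` (excluded) to `c` into `W` and `u` to a
boundary point of `W`. -/
structure IsGap (W : Set X) (h : ℝ → X) (u c : ℝ) : Prop where
  left_mem : u ∈ Icc (0 : ℝ) 1
  right_mem : c ∈ Icc (0 : ℝ) 1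
  map_left_mem : h u ∈ closure W \ W
  map_mem : ∀ t ∈ Ioc (0 : ℝ) 1, h (u + t * (c - u)) ∈ W

theorem add_mul_sub_mem_Icc {u c t : ℝ} (hu : u ∈ Icc (0 : ℝ) 1) (hc : c ∈ Icc (0 : ℝ) 1)
    (ht : t ∈ Icc (0 : ℝ) 1) : u + t * (c - u) ∈ Icc (0 : ℝ) 1 :=
  convex_Icc 0 1 |>.add_smul_sub_mem hu hc ht

theorem continuousOn_segment {h : ℝ → X} (hh : ContinuousOn h (Icc 0 1)) {u c : ℝ}
    (hu : u ∈ Icc (0 : ℝ) 1) (hc : c ∈ Icc (0 : ℝ) 1) :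
    ContinuousOn (fun t => h (u + t * (c - u))) (Icc 0 1) :=
  hh.comp (by fun_prop) fun _ => add_mul_sub_mem_Icc hu hc

theorem IsGap.map_mem_of_lt_of_le {W : Set X} {h : ℝ → X} {u c x : ℝ} (hg : IsGap W h u c)
    (hux : u < x) (hxc : x ≤ c) : h x ∈ W := by
  have hcu : 0 < c - u := by linarith
  have := hg.map_mem ((x - u) / (c - u))
    ⟨div_pos (by linarith) hcu, (div_le_one hcu).2 (by linarith)⟩
  rwa [div_mul_cancel₀ _ hcu.ne', add_sub_cancel] at this

theorem IsGap.map_mem_of_le_of_lt {W : Set X} {h : ℝ → X} {u c x : ℝ} (hg : IsGap W h u c)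
    (hcx : c ≤ x) (hxu : x < u) : h x ∈ W := by
  have hcu : c - u < 0 := by linarith
  have := hg.map_mem ((x - u) / (c - u))
    ⟨div_pos_of_neg_of_neg (by linarith) hcu, (div_le_one_of_neg hcu).2 (by linarith)⟩
  rwa [div_mul_cancel₀ _ hcu.ne, add_sub_cancel] at this

theorem IsGap.eq_left {W : Set X} {h : ℝ → X} {u c u' c' x : ℝ} (hg : IsGap W h u c)
    (hg' : IsGap W h u' c')
    (hx : (u < x ∧ x ≤ c ∧ u' < x ∧ x ≤ c') ∨ (c ≤ x ∧ x < u ∧ c' ≤ x ∧ x < u')) : u = u' := by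
  rcases hx with ⟨h1, h2, h3, h4⟩ | ⟨h1, h2, h3, h4⟩ <;> rcases lt_trichotomy u u' with hl | hl | hl
  · exact (hg'.map_left_mem.2 (hg.map_mem_of_lt_of_le hl (h3.le.trans h2))).elim
  · exact hl
  · exact (hg.map_left_mem.2 (hg'.map_mem_of_lt_of_le hl (h1.le.trans h4))).elim
  · exact (hg.map_left_mem.2 (hg'.map_mem_of_le_of_lt (h3.trans h2.le) hl)).elim
  · exact hl
  · exact (hg'.map_left_mem.2 (hg.map_mem_of_le_of_lt (h1.trans h4.le) hl)).elim

theorem FlowBox.exists_isGap {W : Set X} (hW : IsOpen W) (hWφ : ∀ t, ∀ x, φ t x ∈ W ↔ x ∈ W)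
    {r : ℝ} {h : ℝ → X} {N : Set X} {π σ : X → ℝ} (hB : FlowBox φ r h N π σ) {z w : X}
    (hzN : z ∈ N) (hzW : z ∉ W) (hwN : w ∈ N) (hwW : w ∈ W) : ∃ u c, IsGap W h u c := by
  have hsec : ∀ x ∈ N, h (π x) ∈ W ↔ x ∈ W := fun x hx => by
    conv_rhs => rw [← hB.eq x hx, hWφ]
  have hu := hB.proj_mem z hzN
  have hv := hB.proj_mem w hwN
  set u := π z
  set v := π w
  set γ : ℝ → X := fun t => h (u + t * (v - u)) with hγ
  have hγc : ContinuousOn γ (Icc 0 1) := continuousOn_segment hB.continuousOn_section hu hv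
  have hA : IsCompact (Icc 0 1 ∩ γ ⁻¹' Wᶜ) :=
    isCompact_Icc.of_isClosed_subset (hγc.preimage_isClosed_of_isClosed isClosed_Icc
      hW.isClosed_compl) inter_subset_left
  obtain ⟨s, ⟨hs, hsW⟩, hmax⟩ := hA.exists_isGreatest ⟨0, ⟨le_rfl, zero_le_one⟩, by
    simpa [hγ] using mt (hsec z hzN).1 hzW⟩
  have hs1 : s < 1 := by
    refine hs.2.lt_of_ne fun h1 => hsW ?_
    simpa [hγ, h1] using (hsec w hwN).2 hwW
  have hgt : ∀ t ∈ Ioc s 1, γ t ∈ W := by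
    intro t ht
    by_contra hno
    exact ht.1.not_ge (hmax ⟨⟨hs.1.trans ht.1.le, ht.2⟩, hno⟩)
  refine ⟨u + s * (v - u), v, add_mul_sub_mem_Icc hu hv hs, hv, ⟨?_, hsW⟩, fun t ht => ?_⟩
  · have hcl : s ∈ closure (Ioc s 1) := by
      rw [closure_Ioc hs1.ne]
      exact ⟨le_rfl, hs.2⟩
    exact ((hγc s hs).mono fun t ht => ⟨hs.1.trans ht.1.le, ht.2⟩).mem_closure hcl hgt
  · have := hgt (s + t * (1 - s)) ⟨by nlinarith [ht.1], by nlinarith [ht.2]⟩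
    simp only [hγ] at this
    convert this using 2
    ring

theorem FlowBox.exists_link (hφ : IsFlow φ) {W : Set X} (hWφ : ∀ t, ∀ x, φ t x ∈ W ↔ x ∈ W)
    (hDφ : ∀ t, ∀ x ∈ closure W \ W, φ t x ∈ closure W \ W)
    {h : ℝ → X} {N : Set X} {π σ : X → ℝ} (hB : FlowBox φ (1 / 4) h N π σ) {γ : ℝ → X}
    (hγ : ContinuousOn γ (Icc 0 1)) (hγ0 : γ 0 ∈ closure W \ W)
    (hγW : ∀ t ∈ Ioc (0 : ℝ) 1, γ t ∈ W) {a : ℝ} (ha : 0 < a) (ha1 : a ≤ 1)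
    (haN : ∀ t ∈ Icc 0 a, φ (-1) (γ t) ∈ N) :
    ∃ u c, IsGap W h u c ∧ Link φ γ (fun t => h (u + t * (c - u))) ∧
      ∃ θ, 1 / 2 ≤ θ ∧ h c = φ (-θ) (γ a) := by
  have hsub : Icc 0 a ⊆ Icc 0 1 := Icc_subset_Icc_right ha1
  have hc : ContinuousOn (fun t => φ (-1) (γ t)) (Icc 0 a) :=
    hφ.continuousOn continuousOn_const (hγ.mono hsub)
  set G : ℝ → ℝ := fun t => π (φ (-1) (γ t)) with hG
  set θ : ℝ → ℝ := fun t => 1 + σ (φ (-1) (γ t)) with hθ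
  have hGc : ContinuousOn G (Icc 0 a) := hB.continuousOn_proj.comp hc haN
  have hθc : ContinuousOn θ (Icc 0 a) :=
    continuousOn_const.add (hB.continuousOn_time.comp hc haN)
  have hGm : ∀ t ∈ Icc 0 a, G t ∈ Icc (0 : ℝ) 1 := fun t ht => hB.proj_mem _ (haN t ht)
  have hθ2 : ∀ t ∈ Icc 0 a, 1 / 2 ≤ θ t := by
    intro t ht
    simp only [hθ]
    linarith [(_root_.abs_le.1 (hB.abs_le _ (haN t ht))).1]
  have hGθ : ∀ t ∈ Icc 0 a, h (G t) = φ (-θ t) (γ t) := by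
    intro t ht
    have := congrArg (φ (-σ (φ (-1) (γ t)))) (hB.eq _ (haN t ht))
    rw [hφ.map_map, neg_add_cancel, hφ.map_zero, hφ.map_map] at this
    rw [this]
    congr 1
    simp only [hθ]
    ring
  have h0 : (0 : ℝ) ∈ Icc 0 a := ⟨le_rfl, ha.le⟩
  have haa : a ∈ Icc 0 a := ⟨ha.le, le_rfl⟩
  have hD0 : h (G 0) ∈ closure W \ W := by
    rw [hGθ 0 h0]
    exact hDφ _ _ hγ0
  have hGW : ∀ t ∈ Ioc 0 a, h (G t) ∈ W := by
    intro t ht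
    rw [hGθ t ⟨ht.1.le, ht.2⟩, hWφ]
    exact hγW t ⟨ht.1, ht.2.trans ha1⟩
  have hGne : ∀ t ∈ Ioc 0 a, G t ≠ G 0 := fun t ht he => hD0.2 (he ▸ hGW t ht)
  have hne : G a - G 0 ≠ 0 := sub_ne_zero.2 (hGne a ⟨ha, le_rfl⟩)
  set f : ℝ → ℝ := fun t => (G t - G 0) / (G a - G 0) with hf
  have hfG : ∀ t, G 0 + f t * (G a - G 0) = G t := fun t => by
    simp only [hf]
    rw [div_mul_cancel₀ _ hne, add_sub_cancel]
  have hfc : ContinuousOn f (Icc 0 a) := (hGc.sub continuousOn_const).div_const _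
  have hf0 : f 0 = 0 := by simp [hf]
  have hfa : f a = 1 := div_self hne
  have hfpos : ∀ t ∈ Ioc 0 a, 0 < f t := by
    intro t ht
    by_contra! hle
    obtain ⟨s, hs, hs0⟩ := intermediate_value_Icc ht.2
      (hfc.mono (Icc_subset_Icc_left ht.1.le)) (show (0 : ℝ) ∈ Icc (f t) (f a) from
        ⟨hle, by rw [hfa]; exact zero_le_one⟩)
    refine hGne s ⟨ht.1.trans_le hs.1, hs.2⟩ ?_
    rw [← hfG s, hs0, zero_mul, add_zero]
  obtain ⟨b, hb, hba, hfb⟩ := exists_small_of_continuousOn ha one_pos hfc hf0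
  have hsub' : Icc 0 b ⊆ Icc 0 a := Icc_subset_Icc_right hba
  refine ⟨G 0, G a, ⟨hGm 0 h0, hGm a haa, hD0, fun t ht => ?_⟩,
    ⟨b, f, θ, hb, hba.trans ha1, hfc.mono hsub', hθc.mono hsub', hf0,
      fun t ht => ⟨hfpos t ⟨ht.1, ht.2.trans hba⟩, hfb t ⟨ht.1.le, ht.2⟩⟩,
      fun t ht => ⟨hθ2 t (hsub' ht), ?_⟩⟩, θ a, hθ2 a haa, hGθ a haa⟩
  · obtain ⟨s, hs, rfl⟩ := intermediate_value_Icc ha.le hfc (show t ∈ Icc (f 0) (f a) by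
      rw [hf0, hfa]
      exact ⟨ht.1.le, ht.2⟩)
    rw [hfG]
    refine hGW s ⟨hs.1.lt_of_ne fun h0s => ?_, hs.2⟩
    rw [← h0s, hf0] at ht
    exact ht.1.false
  · simp only [hfG]
    exact hGθ t (hsub' ht)

theorem exists_lebesgue_number {ι : Type*} [Finite ι] {h : ι → ℝ → X} {N : ι → Set X}
    (hh : ∀ i, ContinuousOn (h i) (Icc 0 1)) (hN : ∀ i, IsOpen (N i)) {D : Set X}
    (hD : IsCompact D) (hDN : D ⊆ ⋃ i, N i) :
    ∃ l > (0 : ℝ), ∀ i, ∀ u ∈ Icc (0 : ℝ) 1, h i u ∈ D →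
      ∃ j, ∀ v ∈ Icc (0 : ℝ) 1, |v - u| < l → h i v ∈ N j := by
  obtain ⟨δ, hδ, hδN⟩ := lebesgue_number_lemma_of_metric hD hN hDN
  have hunif : ∀ i, ∃ l > (0 : ℝ), ∀ u ∈ Icc (0 : ℝ) 1, ∀ v ∈ Icc (0 : ℝ) 1,
      dist u v < l → dist (h i u) (h i v) < δ := fun i =>
    Metric.uniformContinuousOn_iff.1
      (isCompact_Icc.uniformContinuousOn_of_continuous (hh i)) δ hδ
  choose l hl hlδ using hunif
  obtain ⟨m, hm⟩ := (eventually_all.2 fun i => Ioo_mem_nhdsGT (hl i) :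
    ∀ᶠ m in 𝓝[>] (0 : ℝ), ∀ i, m ∈ Ioo 0 (l i)).and self_mem_nhdsWithin |>.exists
  refine ⟨m, hm.2, fun i u hu hud => ?_⟩
  obtain ⟨j, hj⟩ := hδN _ hud
  refine ⟨j, fun v hv hvu => hj ?_⟩
  exact hlδ i v hv u hu (hvu.trans (hm.1 i).2)

theorem exists_grid_point {M : ℕ} {l u c : ℝ} (hM : 0 < M) (hMl : 1 / (M : ℝ) < l)
    (hc : c ∈ Icc (0 : ℝ) 1) (h : l ≤ |c - u|) :
    ∃ k : Fin (M + 1), (u < c ∧ u < k / M ∧ (k : ℝ) / M ≤ c) ∨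
      (c < u ∧ c ≤ k / M ∧ (k : ℝ) / M < u) := by
  have hM' : (0 : ℝ) < M := Nat.cast_pos.2 hM
  have hcM : 0 ≤ c * M := mul_nonneg hc.1 hM'.le
  have hcM' : c * M ≤ M := mul_le_of_le_one_left hM'.le hc.2
  have hM1 : 0 < 1 / (M : ℝ) := one_div_pos.2 hM'
  rcases le_total 0 (c - u) with hs | hs
  · rw [abs_of_nonneg hs] at h
    refine ⟨⟨⌊c * M⌋₊, Nat.lt_succ_of_le (Nat.floor_le_of_le hcM')⟩, Or.inl ⟨by linarith, ?_, ?_⟩⟩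
    · have h1 : c < (⌊c * M⌋₊ + 1) / M := (lt_div_iff₀ hM').2 (Nat.lt_floor_add_one _)
      rw [add_div] at h1
      simp only
      linarith
    · exact (div_le_iff₀ hM').2 (Nat.floor_le hcM)
  · rw [abs_of_nonpos hs] at h
    refine ⟨⟨⌈c * M⌉₊, Nat.lt_succ_of_le (Nat.ceil_le.2 hcM')⟩, Or.inr ⟨by linarith, ?_, ?_⟩⟩
    · exact (le_div_iff₀ hM').2 (Nat.le_ceil _)
    · have h1 : (⌈c * M⌉₊ : ℝ) / M < (c * M + 1) / M :=
        (div_lt_div_iff_of_pos_right hM').2 (Nat.ceil_lt_add_one hcM)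
      rw [add_div, mul_div_cancel_right₀ _ hM'.ne'] at h1
      simp only
      linarith

theorem exists_common_grid_point {ι : Type*} [Finite ι] {i : ℕ → ι} {u c : ℕ → ℝ} {l : ℝ}
    (hl : 0 < l) (hc : ∀ n, c n ∈ Icc (0 : ℝ) 1) (h : ∃ᶠ n in atTop, l ≤ |c n - u n|) :
    ∃ m n, m < n ∧ i m = i n ∧ ∃ x, (u m < x ∧ x ≤ c m ∧ u n < x ∧ x ≤ c n) ∨
      (c m ≤ x ∧ x < u m ∧ c n ≤ x ∧ x < u n) := by
  obtain ⟨M, hM⟩ := exists_nat_one_div_lt hl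
  have hgrid : ∀ n, l ≤ |c n - u n| → _ := fun n hn =>
    exists_grid_point M.succ_pos (by exact_mod_cast hM) (hc n) hn
  choose! k hk using hgrid
  have hinf := Nat.frequently_atTop_iff_infinite.1 h
  obtain ⟨m, hm, n, hn, hmn, he⟩ := hinf.exists_lt_map_eq_of_mapsTo
    (f := fun n => (i n, k n, u n < c n)) (mapsTo_univ _ _) finite_univ
  simp only [Prod.mk.injEq, eq_iff_iff] at he
  obtain ⟨hi, hkk, hs⟩ := he
  refine ⟨m, n, hmn, hi, ((k m : ℕ) : ℝ) / (M.succ : ℕ), ?_⟩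
  rcases hk m hm with ⟨h1, h2, h3⟩ | ⟨h1, h2, h3⟩ <;> rcases hk n hn with ⟨h4, h5, h6⟩ | ⟨h4, h5, h6⟩
  · exact Or.inl ⟨h2, h3, hkk ▸ h5, hkk ▸ h6⟩
  · exact (h4.not_gt (hs.1 h1)).elim
  · exact (h1.not_gt (hs.2 h4)).elim
  · exact Or.inr ⟨h2, h3, hkk ▸ h5, hkk ▸ h6⟩

/-- A regular point on the frontier of an unstable set yields a curve which the backward flow
returns to itself, or a backward orbit away from `p`. -/
theorem false_of_flowBoxes (hφ : IsFlow φ) (hpe : PosKinematicExpansive φ)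
    (hp : ∀ t, φ t p = p) {ι : Type*} [Finite ι] {h : ι → ℝ → X} {N : ι → Set X}
    {π σ : ι → X → ℝ} (hB : ∀ i, FlowBox φ (1 / 4) (h i) (N i) (π i) (σ i))
    (hW : IsOpen (unstableSet φ p)) (hD : IsCompact (closure (unstableSet φ p) \ unstableSet φ p))
    (hDne : (closure (unstableSet φ p) \ unstableSet φ p).Nonempty)
    (hDN : closure (unstableSet φ p) \ unstableSet φ p ⊆ ⋃ i, N i) : False := by
  set W := unstableSet φ p with hWdef
  have hWφ : ∀ t, ∀ x, φ t x ∈ W ↔ x ∈ W := fun t _ => hφ.mem_unstableSet_iff t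
  have hDφ : ∀ t, ∀ x ∈ closure W \ W, φ t x ∈ closure W \ W :=
    fun t _ hx => hφ.map_mem_closure_diff t hx
  have hpsec : ∀ i, p ∉ h i '' Icc 0 1 := by
    rintro i ⟨u, hu, rfl⟩
    obtain ⟨t, ht⟩ := (hB i).exists_ne u hu
    exact ht (hp t)
  have hflow : ∀ i, ContinuousOn (fun u => φ (-1) (h i u)) (Icc 0 1) := fun i =>
    hφ.continuousOn continuousOn_const (hB i).continuousOn_section
  obtain ⟨l, hl, hlN⟩ := exists_lebesgue_number hflow (fun i => (hB i).isOpen) hD hDN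
  let Q := {q : ι × ℝ × ℝ // IsGap W (h q.1) q.2.1 q.2.2}
  let P : Q → ℝ → X := fun q t => h q.1.1 (q.1.2.1 + t * (q.1.2.2 - q.1.2.1))
  have hPc : ∀ q, ContinuousOn (P q) (Icc 0 1) := fun q =>
    continuousOn_segment (hB q.1.1).continuousOn_section q.2.left_mem q.2.right_mem
  have hP1 : ∀ q, P q 1 = h q.1.1 q.1.2.2 := fun q => by simp [P]
  have hP0 : ∀ q, P q 0 = h q.1.1 q.1.2.1 := fun q => by simp [P]
  have hstep : ∀ q : Q, ∃ q' : Q, Link φ (P q) (P q') ∧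
      (|q.1.2.2 - q.1.2.1| < l → ∃ θ, 1 / 2 ≤ θ ∧ P q' 1 = φ (-θ) (P q 1)) := by
    intro q
    obtain ⟨⟨i, u, c⟩, hq⟩ := q
    simp only at hq
    obtain ⟨j, hj⟩ := hlN i u hq.left_mem (hDφ _ _ hq.map_left_mem)
    obtain ⟨a, ha, ha1, hal, hal'⟩ : ∃ a : ℝ, 0 < a ∧ a ≤ 1 ∧ a * |c - u| < l ∧
        (|c - u| < l → a = 1) := by
      by_cases hcl : |c - u| < l
      · exact ⟨1, one_pos, le_rfl, by rwa [one_mul], fun _ => rfl⟩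
      · have hcpos : 0 < |c - u| := hl.trans_le (not_lt.1 hcl)
        refine ⟨l / |c - u| / 2, by positivity, ?_, ?_, fun h => (hcl h).elim⟩
        · have := (div_le_one hcpos).2 (not_lt.1 hcl)
          linarith
        · rw [div_mul_eq_mul_div, div_mul_cancel₀ _ hcpos.ne']
          exact half_lt_self hl
    obtain ⟨u', c', hg, hL, θ, hθ, hθe⟩ := (hB j).exists_link hφ hWφ hDφ
      (γ := P ⟨(i, u, c), hq⟩) (hPc _) (by rw [hP0]; exact hq.map_left_mem) hq.map_mem ha ha1
      fun t ht => hj _ (add_mul_sub_mem_Icc hq.left_mem hq.right_mem ⟨ht.1, ht.2.trans ha1⟩) (by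
        rw [add_sub_cancel_left, abs_mul, abs_of_nonneg ht.1]
        exact (mul_le_mul_of_nonneg_right ht.2 (abs_nonneg _)).trans_lt hal)
    refine ⟨⟨(j, u', c'), hg⟩, hL, fun hcl => ⟨θ, hθ, ?_⟩⟩
    rw [hal' hcl] at hθe
    rw [hP1 ⟨(j, u', c'), hg⟩]
    exact hθe
  choose S hSL hSθ using hstep
  obtain ⟨z, hz⟩ := hDne
  obtain ⟨i₀, hzi⟩ := mem_iUnion.1 (hDN hz)
  obtain ⟨w, hwN, hwW⟩ := mem_closure_iff.1 hz.1 _ (hB i₀).isOpen hzi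
  obtain ⟨u₀, c₀, hg₀⟩ := (hB i₀).exists_isGap hW hWφ hzi hz.2 hwN hwW
  let q : ℕ → Q := fun n => S^[n] ⟨(i₀, u₀, c₀), hg₀⟩
  have hq : ∀ n, q (n + 1) = S (q n) := fun n => Function.iterate_succ_apply' S n _
  have hlink : ∀ m k, Link φ (P (q m)) (P (q (m + k + 1))) := by
    intro m k
    induction k with
    | zero =>
      rw [add_zero, hq]
      exact hSL _
    | succ k ih =>
      rw [← add_assoc, hq (m + k + 1)]
      exact ih.trans hφ (hSL _)
  by_cases hfreq : ∃ᶠ n in atTop, l ≤ |(q n).1.2.2 - (q n).1.2.1|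
  · obtain ⟨m, n, hmn, hi, x, hx⟩ := exists_common_grid_point (i := fun n => (q n).1.1) hl
      (fun n => (q n).2.right_mem) hfreq
    obtain ⟨k, rfl⟩ := Nat.exists_eq_add_of_lt hmn
    have hL := hlink m k
    generalize q (m + k + 1) = q' at hi hx hL
    generalize q m = r at hi hx hL
    obtain ⟨⟨i, u, c⟩, hr⟩ := r
    obtain ⟨⟨i', u', c'⟩, hr'⟩ := q'
    simp only at hi hx hr hr'
    subst hi
    obtain rfl := hr.eq_left hr' hx
    have hκ : 0 < (c' - u) / (c - u) := by
      rcases hx with ⟨h1, h2, h3, h4⟩ | ⟨h1, h2, h3, h4⟩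
      · exact div_pos (by linarith) (by linarith)
      · exact div_pos_of_neg_of_neg (by linarith) (by linarith)
    have hcu : c - u ≠ 0 := fun h0 => by
      rw [h0, div_zero] at hκ
      exact hκ.false
    refine hφ.false_of_first_return hpe (hPc ⟨(i, u, c), hr⟩) hr.map_mem ?_
      (Link.of_rescale hκ ?_)
    · rintro ⟨t, ht, he⟩
      exact hpsec i ⟨_, add_mul_sub_mem_Icc hr.left_mem hr.right_mem ht, he⟩
    · convert hL using 2 with t
      simp only [P]
      congr 2
      field_simp
  · obtain ⟨n₀, hn₀⟩ := eventually_atTop.1 (not_frequently.1 hfreq)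
    have hshort : ∀ k, ∃ θ, 1 / 2 ≤ θ ∧ P (q (n₀ + k + 1)) 1 = φ (-θ) (P (q (n₀ + k)) 1) := by
      intro k
      rw [hq]
      exact hSθ _ (not_le.1 (hn₀ _ (Nat.le_add_right _ _)))
    choose θ hθ hθe using hshort
    have horb : ∀ k, φ (-∑ i ∈ Finset.range k, θ i) (P (q n₀) 1) = P (q (n₀ + k)) 1 := by
      intro k
      induction k with
      | zero => simp [hφ.map_zero]
      | succ k ih =>
        rw [← add_assoc, hθe, ← ih, hφ.map_map, Finset.sum_range_succ]
        congr 1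
        ring
    have hΘ : ∀ k : ℕ, k * (1 / 2 : ℝ) ≤ ∑ i ∈ Finset.range k, θ i := by
      intro k
      have := Finset.card_nsmul_le_sum (Finset.range k) θ (1 / 2) fun i _ => hθ i
      simpa using this
    refine false_of_recurrent_backward (φ := φ) (p := p) (x := P (q n₀) 1)
      (K := ⋃ i, h i '' Icc 0 1)
      ((q n₀).2.map_mem 1 ⟨one_pos, le_rfl⟩)
      (isClosed_iUnion_of_finite fun i =>
        (isCompact_Icc.image_of_continuousOn (hB i).continuousOn_section).isClosed)
      (fun hpm => ?_)
      (tendsto_atTop_mono hΘ (tendsto_natCast_atTop_atTop.atTop_mul_const (by norm_num)))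
      fun k => ?_
    · obtain ⟨i, hpi⟩ := mem_iUnion.1 hpm
      exact hpsec i hpi
    · rw [horb, hP1]
      exact mem_iUnion.2 ⟨_, _, (q (n₀ + k)).2.right_mem, rfl⟩

theorem false_of_fixedPoint [CompactSpace X] [ConnectedSpace X]
    [ChartedSpace (EuclideanHalfSpace 2) X] (hφ : IsFlow φ) (hpe : PosKinematicExpansive φ)
    (hp : ∀ t, φ t p = p) : False := by
  have : Nontrivial X := nontrivial_of_chartedSpace_euclideanHalfSpace X
  have hW := hφ.isOpen_unstableSet hpe hp
  have hD : IsCompact (closure (unstableSet φ p) \ unstableSet φ p) :=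
    (isClosed_closure.inter hW.isClosed_compl).isCompact
  have hbox : ∀ z : ↥(closure (unstableSet φ p) \ unstableSet φ p), ∃ h N π τ, z.1 ∈ N ∧
      FlowBox φ (1 / 4) h N π τ := fun z =>
    exists_flowBox hφ (hφ.exists_ne_of_mem_closure_diff hpe hp z.2)
      (fun t _ hx => (hφ.mem_unstableSet_iff t).2 hx) z.2.1 z.2.2 (by norm_num)
  choose h N π τ hzN hB using hbox
  obtain ⟨s, hs⟩ := hD.elim_finite_subcover N (fun z => (hB z).isOpen)
    fun z hz => mem_iUnion.2 ⟨⟨z, hz⟩, hzN ⟨z, hz⟩⟩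
  refine hφ.false_of_flowBoxes hpe hp (ι := s) (fun i => hB i) hW hD
    (hφ.exists_mem_closure_diff_unstableSet hpe hp) fun z hz => ?_
  obtain ⟨i, hi, hzi⟩ := mem_iUnion₂.1 (hs hz)
  exact mem_iUnion.2 ⟨⟨i, hi⟩, hzi⟩

end IsFlow

/-- A positive kinematic expansive continuous flow on a compact surface has no
singular points. -/
theorem stmt19 {S : Type*} [MetricSpace S] [CompactSpace S] [ConnectedSpace S]
    [ChartedSpace (EuclideanHalfSpace 2) S]
    (φ : ℝ → S → S) (hφ : IsFlow φ) (hpe : PosKinematicExpansive φ) :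
    ∀ p : S, ¬ ∀ t : ℝ, φ t p = p := by
  intro p hp
  exact hφ.false_of_fixedPoint hpe hp
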